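/- arXiv:1501.04507 — 2 statements merged into one kernel-verified Lean document; each statement's English description precedes it below -/
import Mathlib

section
/- Let f be a univalent map on 𝔹ₙ. The following are equivalent: (a) f(𝔹ₙ) is a Runge domain; (b) the inverse map f⁻¹ : f(𝔹ₙ) → 𝔹ₙ is the limit, locally uniformly on f(𝔹ₙ), of a sequence of polynomial maps; (c) for every holomorphic g : 𝔹ₙ → ℂⁿ there is a sequence of polynomial maps p_k such that p_k ∘ f → g locally uniformly on 𝔹ₙ. -/
open Metric Filter Set

noncomputable section

/-- ℂⁿ with the Euclidean (Hermitian) norm. -/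
abbrev En (n : ℕ) : Type := EuclideanSpace ℂ (Fin n)

/-- The open Euclidean unit ball 𝔹ₙ ⊂ ℂⁿ. -/
def Ball (n : ℕ) : Set (En n) := Metric.ball 0 1

/-- A map is univalent on 𝔹ₙ if it is holomorphic and injective there. -/
def UnivalentOn (n : ℕ) (f : En n → En n) : Prop :=
  DifferentiableOn ℂ f (Ball n) ∧ Set.InjOn f (Ball n)

/-- A polynomial map ℂⁿ → ℂⁿ: each of the n components is a polynomial in the
n complex coordinates. -/
def IsPolyMap (n : ℕ) (p : En n → En n) : Prop :=
  ∃ q : Fin n → MvPolynomial (Fin n) ℂ,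
    ∀ z : En n, ∀ i : Fin n, p z i = MvPolynomial.eval (fun j => z j) (q i)

/-- The Runge approximation property for a set Ω ⊆ ℂⁿ: every holomorphic map
Ω → ℂⁿ is a locally uniform limit on Ω of polynomial maps. -/
def RungeOn (n : ℕ) (Ω : Set (En n)) : Prop :=
  ∀ g : En n → En n, DifferentiableOn ℂ g Ω →
    ∃ p : ℕ → En n → En n, (∀ k, IsPolyMap n (p k)) ∧
      TendstoLocallyUniformlyOn p g atTop Ω

section Helpers
set_option linter.unusedSectionVars false
open scoped Topology ContDiff


section Osg
variable {E F : Type} [NormedAddCommGroup E] [NormedSpace ℂ E] [FiniteDimensional ℂ E]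
  [NormedAddCommGroup F] [NormedSpace ℂ F] [FiniteDimensional ℂ F]

theorem osg_line_deriv {E F : Type} [NormedAddCommGroup E] [NormedSpace ℂ E]
    [NormedAddCommGroup F] [NormedSpace ℂ F] {f : E → F} {z u : E} {c : ℂ}
    (hf : DifferentiableAt ℂ f (z + c • u)) :
    HasDerivAt (fun ζ : ℂ => f (z + ζ • u)) (fderiv ℂ f (z + c • u) u) c := by
  have h1 : HasDerivAt (fun ζ : ℂ => z + ζ • u) u c := by
    simpa using ((hasDerivAt_id c).smul_const u).const_add z
  exact hf.hasFDerivAt.comp_hasDerivAt c h1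

theorem osg_fderiv_bound {f : E → F} {U : Set E} (hU : IsOpen U) (hf : DifferentiableOn ℂ f U)
    {z : E} {ρ M : ℝ} (hρ : 0 < ρ) (hz : closedBall z ρ ⊆ U)
    (hM : ∀ x ∈ closedBall z ρ, ‖f x‖ ≤ M) : ‖fderiv ℂ f z‖ ≤ M / ρ := by
  have hM0 : 0 ≤ M := (norm_nonneg _).trans (hM z (mem_closedBall_self hρ.le))
  refine ContinuousLinearMap.opNorm_le_bound _ (by positivity) fun u => ?_
  rcases eq_or_ne u 0 with rfl | hu
  · simp
  have hu' : 0 < ‖u‖ := norm_pos_iff.2 hu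
  have hmem : ∀ ζ : ℂ, ζ ∈ closedBall (0:ℂ) (ρ / ‖u‖) → z + ζ • u ∈ closedBall z ρ := by
    intro ζ hζ
    rw [mem_closedBall_zero_iff, le_div_iff₀ hu'] at hζ
    simpa [mem_closedBall, dist_eq_norm, norm_smul] using hζ
  have hd : ∀ ζ : ℂ, ζ ∈ closedBall (0:ℂ) (ρ / ‖u‖) →
      HasDerivAt (fun ζ : ℂ => f (z + ζ • u)) (fderiv ℂ f (z + ζ • u) u) ζ := fun ζ hζ =>
    osg_line_deriv (hf.differentiableAt (hU.mem_nhds (hz (hmem ζ hζ))))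
  have hR : 0 < ρ / ‖u‖ := by positivity
  have := Complex.norm_deriv_le_of_forall_mem_sphere_norm_le (c := 0) (C := M)
    (f := fun ζ : ℂ => f (z + ζ • u)) hR
    (DifferentiableOn.diffContOnCl (by
      rw [closure_ball _ hR.ne']
      exact fun ζ hζ => (hd ζ hζ).differentiableAt.differentiableWithinAt))
    (fun ζ hζ => hM _ (hmem ζ (sphere_subset_closedBall hζ)))
  rw [(hd 0 (mem_closedBall_self hR.le)).deriv] at this
  simp only [zero_smul, add_zero] at this
  refine this.trans (le_of_eq ?_)
  field_simp

theorem osg_fderiv_apply {f : E → F} {U : Set E} (hU : IsOpen U) (hf : DifferentiableOn ℂ f U)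
    (v : E) : DifferentiableOn ℂ (fun z => fderiv ℂ f z v) U := by
  intro a ha
  apply DifferentiableAt.differentiableWithinAt
  have : ProperSpace E := FiniteDimensional.proper ℂ E
  have : CompleteSpace F := FiniteDimensional.complete ℂ F
  obtain ⟨ρ', hρ', hb⟩ := Metric.nhds_basis_closedBall.mem_iff.1 (hU.mem_nhds ha)
  set ρ := ρ' / 3 with hρdef
  have hρ : 0 < ρ := by positivity
  obtain ⟨M, hM⟩ := (isCompact_closedBall a ρ').exists_bound_of_continuousOn
    (hf.continuousOn.mono hb)
  set r := ρ / (‖v‖ + 1) with hr_def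
  have hr : 0 < r := by positivity
  have hrv : ∀ w : ℂ, ‖w‖ ≤ r → ‖w • v‖ ≤ ρ := by
    intro w hw
    rw [norm_smul]
    calc ‖w‖ * ‖v‖ ≤ r * (‖v‖ + 1) := by gcongr; linarith
      _ = ρ := by rw [hr_def]; field_simp
  have hin : ∀ z ∈ ball a ρ, ∀ w : ℂ, ‖w‖ ≤ r → z + w • v ∈ closedBall a (2 * ρ) := by
    intro z hz w hw
    rw [mem_ball, dist_eq_norm] at hz
    rw [mem_closedBall, dist_eq_norm]
    have := hrv w hw
    calc ‖z + w • v - a‖ = ‖(z - a) + w • v‖ := by congr 1; abel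
      _ ≤ ‖z - a‖ + ‖w • v‖ := norm_add_le _ _
      _ ≤ 2 * ρ := by linarith
  have hsub : closedBall a (2 * ρ) ⊆ U :=
    (closedBall_subset_closedBall (by rw [hρdef]; linarith)).trans hb
  have hbd : ∀ x ∈ closedBall a (2 * ρ), ‖fderiv ℂ f x‖ ≤ M / ρ := by
    intro x hx
    have hs : closedBall x ρ ⊆ closedBall a ρ' := by
      apply closedBall_subset_closedBall'
      rw [mem_closedBall] at hx
      rw [hρdef] at hx ⊢; linarith
    exact osg_fderiv_bound hU hf hρ (hs.trans hb) (fun y hy => hM y (hs hy))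
  have hcm : ∀ θ : ℝ, ‖circleMap 0 r θ‖ ≤ r := fun θ => by
    rw [norm_circleMap_zero, abs_of_pos hr]
  -- Cauchy formula
  have hcauchy : ∀ z ∈ ball a ρ, fderiv ℂ f z v =
      (2 * Real.pi * Complex.I : ℂ)⁻¹ • ∫ θ in (0:ℝ)..2 * Real.pi,
        (deriv (circleMap 0 r) θ * ((circleMap 0 r θ) ^ 2)⁻¹) • f (z + circleMap 0 r θ • v) := by
    intro z hz
    have hV : IsOpen {w : ℂ | z + w • v ∈ U} := hU.preimage (by fun_prop)
    have hd : ∀ w ∈ {w : ℂ | z + w • v ∈ U},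
        HasDerivAt (fun ζ : ℂ => f (z + ζ • v)) (fderiv ℂ f (z + w • v) v) w := fun w hw =>
      osg_line_deriv (hf.differentiableAt (hU.mem_nhds hw))
    have := Complex.cderiv_eq_deriv (f := fun w : ℂ => f (z + w • v)) (z := 0) hV
      (fun w hw => (hd w hw).differentiableAt.differentiableWithinAt) hr
      (fun w hw => hsub (hin z hz w (mem_closedBall_zero_iff.1 hw)))
    rw [(hd 0 (by simpa using hsub (hin z hz 0 (by simpa using hr.le)))).deriv] at this
    simp only [zero_smul, add_zero] at this
    rw [← this, Complex.cderiv, circleIntegral]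
    simp only [sub_zero, smul_smul]
  have hev : (fun z => fderiv ℂ f z v) =ᶠ[𝓝 a] fun z =>
      (2 * Real.pi * Complex.I : ℂ)⁻¹ • ∫ θ in (0:ℝ)..2 * Real.pi,
        (deriv (circleMap 0 r) θ * ((circleMap 0 r θ) ^ 2)⁻¹) • f (z + circleMap 0 r θ • v) := by
    filter_upwards [ball_mem_nhds a hρ] with z hz using hcauchy z hz
  refine DifferentiableAt.congr_of_eventuallyEq ?_ hev
  refine DifferentiableAt.const_smul ?_ _
  have hcne : ∀ θ : ℝ, circleMap 0 r θ ≠ 0 := fun θ => circleMap_ne_center hr.ne'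
  have hk : Continuous fun θ : ℝ => deriv (circleMap 0 r) θ * ((circleMap 0 r θ) ^ 2)⁻¹ := by
    simp only [deriv_circleMap]
    exact ((continuous_circleMap 0 r).mul continuous_const).mul
      (((continuous_circleMap 0 r).pow 2).inv₀ fun θ => pow_ne_zero 2 (hcne θ))
  have hcont : ∀ z ∈ ball a ρ, Continuous fun θ : ℝ =>
      (deriv (circleMap 0 r) θ * ((circleMap 0 r θ) ^ 2)⁻¹) • f (z + circleMap 0 r θ • v) := by
    intro z hz
    refine hk.smul ?_
    exact hf.continuousOn.comp_continuous (by fun_prop) fun θ => hsub (hin z hz _ (hcm θ))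
  let : MeasurableSpace E := borel E
  have : BorelSpace E := ⟨rfl⟩
  let : MeasurableSpace F := borel F
  have : BorelSpace F := ⟨rfl⟩
  have : ProperSpace (E →L[ℂ] F) := FiniteDimensional.proper ℂ _
  have hmeas : Measurable fun θ : ℝ => fderiv ℂ f (a + circleMap 0 r θ • v) :=
    (measurable_fderiv ℂ f).comp (by
      have : Continuous fun θ : ℝ => a + circleMap 0 r θ • v := by fun_prop
      exact this.measurable)
  refine (intervalIntegral.hasFDerivAt_integral_of_dominated_of_fderiv_le (𝕜 := ℂ)
    (F' := fun z θ => (deriv (circleMap 0 r) θ * ((circleMap 0 r θ) ^ 2)⁻¹) •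
      fderiv ℂ f (z + circleMap 0 r θ • v))
    (bound := fun θ => ‖deriv (circleMap 0 r) θ * ((circleMap 0 r θ) ^ 2)⁻¹‖ * (M / ρ))
    (ball_mem_nhds a hρ) ?_ ?_ ?_ ?_ ?_ ?_).differentiableAt
  · filter_upwards [ball_mem_nhds a hρ] with z hz using (hcont z hz).aestronglyMeasurable
  · exact (hcont a (mem_ball_self hρ)).intervalIntegrable _ _
  · exact hk.aestronglyMeasurable.smul hmeas.aestronglyMeasurable
  · refine Eventually.of_forall fun θ _ z hz => ?_
    rw [norm_smul]
    gcongr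
    exact hbd _ (hin z hz _ (hcm θ))
  · exact (hk.norm.mul continuous_const).intervalIntegrable _ _
  · refine Eventually.of_forall fun θ _ z hz => ?_
    refine HasFDerivAt.const_smul ?_ _
    have h1 := (hf.differentiableAt (hU.mem_nhds (hsub (hin z hz _ (hcm θ))))).hasFDerivAt
    exact h1.comp z ((hasFDerivAt_id z).add_const _)

theorem osg_fderiv {f : E → F} {U : Set E} (hU : IsOpen U) (hf : DifferentiableOn ℂ f U) :
    DifferentiableOn ℂ (fderiv ℂ f) U := by
  let b := Module.finBasis ℂ E
  -- write fderiv as a finite sum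
  have : fderiv ℂ f = fun z => ∑ i, ((LinearMap.toContinuousLinearMap (b.coord i)).smulRight
      (fderiv ℂ f z (b i)) : E →L[ℂ] F) := by
    funext z
    ext x
    simp only [sum_apply, ContinuousLinearMap.smulRight_apply]
    conv_lhs => rw [← b.sum_repr x, map_sum]
    simp
  rw [this]
  refine DifferentiableOn.fun_sum fun i _ => ?_
  exact ((ContinuousLinearMap.smulRightL ℂ E F
    (LinearMap.toContinuousLinearMap (b.coord i))).differentiable.comp_differentiableOn
      (osg_fderiv_apply hU hf (b i)))

end Osg

theorem osg_contDiffOn {E : Type} [NormedAddCommGroup E] [NormedSpace ℂ E]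
    [FiniteDimensional ℂ E] {U : Set E} (hU : IsOpen U) (m : ℕ) :
    ∀ (F : Type) [NormedAddCommGroup F] [NormedSpace ℂ F] [FiniteDimensional ℂ F] (f : E → F),
      DifferentiableOn ℂ f U → ContDiffOn ℂ m f U := by
  induction m with
  | zero =>
    intro F _ _ _ f hf
    simpa using hf.continuousOn
  | succ m ih =>
    intro F _ _ _ f hf
    push_cast
    rw [contDiffOn_succ_iff_fderiv_of_isOpen hU]
    exact ⟨hf, by simp, ih _ _ (osg_fderiv hU hf)⟩


theorem osg_one {φ : ℂ → ℂ} (hφ : AnalyticAt ℂ φ 0) {s : Set ℂ} (hs : s ∈ 𝓝 (0:ℂ))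
    (hinj : InjOn φ s) : deriv φ 0 ≠ 0 := by
  have hψ : AnalyticAt ℂ (fun z => φ z - φ 0) 0 := hφ.sub analyticAt_const
  have hne : analyticOrderAt (fun z => φ z - φ 0) 0 ≠ ⊤ := by
    intro h
    rw [analyticOrderAt_eq_top] at h
    have h2 : ∀ᶠ z in 𝓝 (0:ℂ), z = 0 := by
      filter_upwards [h, hs] with z hz hzs
      exact hinj hzs (mem_of_mem_nhds hs) (sub_eq_zero.1 hz)
    have h3 : ∀ᶠ z in 𝓝[≠] (0:ℂ), False := by
      filter_upwards [h2.filter_mono nhdsWithin_le_nhds, self_mem_nhdsWithin] with z hz hz'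
      exact hz' hz
    exact (h3.exists).elim fun _ h => h
  rw [hψ.analyticOrderAt_ne_top] at hne
  obtain ⟨g, hg, hg0, hev⟩ := hne
  set m := analyticOrderNatAt (fun z => φ z - φ 0) 0 with hm
  clear_value m
  simp only [sub_zero, smul_eq_mul] at hev
  rcases m with _ | _ | m
  · exfalso
    have := hev.self_of_nhds
    simp at this
    exact hg0 this.symm
  · have hd : HasDerivAt φ (g 0) 0 := by
      have h1 : HasDerivAt (fun z => z * g z + φ 0) (1 * g 0 + 0 * deriv g 0) 0 :=
        ((hasDerivAt_id (0:ℂ)).mul hg.differentiableAt.hasDerivAt).add_const _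
      simp only [one_mul, zero_mul, add_zero] at h1
      refine h1.congr_of_eventuallyEq ?_
      filter_upwards [hev] with z hz
      simp at hz
      rw [← hz]; ring
    rw [hd.deriv]; exact hg0
  · exfalso
    set M := m + 1 + 1 with hM
    have hM0 : M ≠ 0 := by omega
    set k : ℂ → ℂ := fun z => (g z / g 0) ^ ((M : ℂ)⁻¹) with hk
    have hka : AnalyticAt ℂ k 0 := by
      refine AnalyticAt.cpow (hg.div analyticAt_const hg0) analyticAt_const ?_
      rw [div_self hg0]; exact Complex.one_mem_slitPlane
    have hk0 : k 0 = 1 := by simp [hk, div_self hg0]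
    have hkM : ∀ z, k z ^ M = g z / g 0 := fun z => Complex.cpow_nat_inv_pow _ hM0
    have hda : AnalyticAt ℂ (fun z => z * k z) 0 := analyticAt_id.mul hka
    have hd : HasDerivAt (fun z => z * k z) 1 0 := by
      have h1 := (hasDerivAt_id (0:ℂ)).mul hka.differentiableAt.hasDerivAt
      have h2 : HasDerivAt (fun z => z * k z) (1 * k 0 + 0 * deriv k 0) 0 := h1
      rwa [hk0, zero_mul, add_zero, one_mul] at h2
    have hsd : HasStrictDerivAt (fun z => z * k z) 1 0 := by
      have := hda.hasStrictDerivAt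
      rwa [hd.deriv] at this
    have hmap := hsd.map_nhds_eq one_ne_zero
    have hs' : {z | z ∈ s ∧ φ z - φ 0 = z ^ M * g z} ∈ 𝓝 (0:ℂ) := by
      filter_upwards [hs, hev] with z h1 h2 using ⟨h1, h2⟩
    have himg : (fun z => z * k z) '' {z | z ∈ s ∧ φ z - φ 0 = z ^ M * g z} ∈ 𝓝 (0:ℂ) := by
      have := image_mem_map (m := fun z => z * k z) hs'
      rw [hmap] at this
      simpa using this
    have hprim := Complex.isPrimitiveRoot_exp M hM0
    set ξ := Complex.exp (2 * Real.pi * Complex.I / M)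
    have hξ1 : ξ ≠ 1 := hprim.ne_one (by omega)
    have hξM : ξ ^ M = 1 := hprim.pow_eq_one
    have htend : Tendsto (fun w : ℂ => ξ * w) (𝓝 0) (𝓝 0) := by
      have : Continuous fun w : ℂ => ξ * w := by fun_prop
      simpa using this.tendsto 0
    have hboth : ∀ᶠ w in 𝓝[≠] (0:ℂ), w ∈ (fun z => z * k z) '' {z | z ∈ s ∧ φ z - φ 0 = z ^ M * g z}
        ∧ ξ * w ∈ (fun z => z * k z) '' {z | z ∈ s ∧ φ z - φ 0 = z ^ M * g z} ∧ w ≠ 0 := by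
      filter_upwards [mem_nhdsWithin_of_mem_nhds himg,
        mem_nhdsWithin_of_mem_nhds (htend himg), self_mem_nhdsWithin] with w h1 h2 h3
      exact ⟨h1, h2, h3⟩
    obtain ⟨w, ⟨z1, ⟨hz1, e1⟩, hw1⟩, ⟨z2, ⟨hz2, e2⟩, hw2⟩, hw0⟩ := hboth.exists
    simp only at hw1 hw2
    have key : ∀ z, z ^ M * g z = g 0 * (z * k z) ^ M := by
      intro z
      rw [mul_pow, hkM]; field_simp
    have heq : φ z1 = φ z2 := by
      have : φ z1 - φ 0 = φ z2 - φ 0 := by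
        rw [e1, e2, key, key, hw1, hw2, mul_pow, hξM, one_mul]
      simpa using this
    have hz := hinj hz1 hz2 heq
    rw [hz, hw2] at hw1
    exact hξ1 (mul_right_cancel₀ hw0 (by rw [hw1, one_mul]))

section Osg
variable {E F : Type} [NormedAddCommGroup E] [NormedSpace ℂ E] [FiniteDimensional ℂ E]
  [NormedAddCommGroup F] [NormedSpace ℂ F] [FiniteDimensional ℂ F]

theorem osg_hurwitz {δ : E → ℂ} {U : Set E} (hU : IsOpen U) (hδ : DifferentiableOn ℂ δ U)
    {a v : E} (ha : a ∈ U) (hδa : δ a = 0)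
    (hiso : ∀ᶠ ζ : ℂ in 𝓝[≠] 0, δ (a + ζ • v) ≠ 0) {ε : ℝ} (hε : 0 < ε) :
    ∀ᶠ x in 𝓝 a, ∃ ζ : ℂ, ‖ζ‖ < ε ∧ δ (x + ζ • v) = 0 := by
  have hline : Continuous fun ζ : ℂ => a + ζ • v := by fun_prop
  have hT : ∀ᶠ ζ : ℂ in 𝓝 0, a + ζ • v ∈ U :=
    hline.tendsto 0 (by simpa using hU.mem_nhds ha)
  rw [eventually_nhdsWithin_iff] at hiso
  obtain ⟨r0, hr0, hb⟩ := Metric.eventually_nhds_iff_ball.1 (hT.and hiso)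
  set r := min (r0 / 2) (ε / 2) with hr_def
  have hr : 0 < r := by positivity
  have hrr0 : r < r0 := (min_le_left _ _).trans_lt (by linarith)
  have hrε : r < ε := (min_le_right _ _).trans_lt (by linarith)
  have hin : ∀ ζ ∈ closedBall (0:ℂ) r, a + ζ • v ∈ U := fun ζ hζ =>
    (hb ζ (closedBall_subset_ball hrr0 hζ)).1
  have hne : ∀ ζ ∈ sphere (0:ℂ) r, δ (a + ζ • v) ≠ 0 := fun ζ hζ =>
    (hb ζ (closedBall_subset_ball hrr0 (sphere_subset_closedBall hζ))).2
      (by rintro rfl; simp [hr.ne] at hζ)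
  have hc : ContinuousOn (fun ζ : ℂ => ‖δ (a + ζ • v)‖) (sphere 0 r) :=
    (hδ.continuousOn.comp hline.continuousOn
      (fun ζ hζ => hin ζ (sphere_subset_closedBall hζ))).norm
  obtain ⟨ζ0, hζ0, hmin⟩ := (isCompact_sphere (0:ℂ) r).exists_isMinOn
    (NormedSpace.sphere_nonempty.2 hr.le) hc
  set m := ‖δ (a + ζ0 • v)‖ with hm
  have hmpos : 0 < m := norm_pos_iff.2 (hne ζ0 hζ0)
  have h2 : Continuous fun p : E × ℂ => p.1 + p.2 • v := by fun_prop
  have hcU : ∀ ζ ∈ closedBall (0:ℂ) r, ContinuousAt (fun p : E × ℂ => δ (p.1 + p.2 • v)) (a, ζ) :=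
    fun ζ hζ => ContinuousAt.comp (f := fun p : E × ℂ => p.1 + p.2 • v) (g := δ) (x := (a, ζ))
      (hδ.continuousOn.continuousAt (hU.mem_nhds (hin ζ hζ))) h2.continuousAt
  have e1 : ∀ᶠ x in 𝓝 a, ∀ ζ ∈ closedBall (0:ℂ) r, x + ζ • v ∈ U :=
    (isCompact_closedBall (0:ℂ) r).eventually_forall_of_forall_eventually fun ζ hζ =>
      h2.tendsto (a, ζ) (hU.mem_nhds (hin ζ hζ))
  have e2 : ∀ᶠ x in 𝓝 a, ∀ ζ ∈ sphere (0:ℂ) r, m / 2 < ‖δ (x + ζ • v)‖ := by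
    refine (isCompact_sphere (0:ℂ) r).eventually_forall_of_forall_eventually fun ζ hζ => ?_
    refine (hcU ζ (sphere_subset_closedBall hζ)).norm.eventually (lt_mem_nhds ?_)
    have := hmin hζ
    have h3 : m ≤ ‖δ (a + ζ • v)‖ := this
    show m / 2 < ‖δ (a + ζ • v)‖
    linarith
  have e3 : ∀ᶠ x in 𝓝 a, ‖δ x‖ < m / 2 := by
    refine (hδ.continuousOn.continuousAt (hU.mem_nhds ha)).norm.eventually (gt_mem_nhds ?_)
    simp only [hδa, norm_zero]; positivity
  filter_upwards [e1, e2, e3] with x h1 h2 h3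
  by_contra hcon
  push Not at hcon
  have hnz : ∀ ζ ∈ closedBall (0:ℂ) r, δ (x + ζ • v) ≠ 0 := fun ζ hζ =>
    hcon ζ ((mem_closedBall_zero_iff.1 hζ).trans_lt hrε)
  have hd : DiffContOnCl ℂ (fun ζ : ℂ => (δ (x + ζ • v))⁻¹) (ball 0 r) := by
    apply DifferentiableOn.diffContOnCl
    rw [closure_ball _ hr.ne']
    intro ζ hζ
    exact ((osg_line_deriv (hδ.differentiableAt
      (hU.mem_nhds (h1 ζ hζ)))).differentiableAt.inv (hnz ζ hζ)).differentiableWithinAt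
  have := Complex.norm_le_of_forall_mem_frontier_norm_le isBounded_ball hd (C := (m / 2)⁻¹)
    (fun ζ hζ => by
      rw [frontier_ball _ hr.ne'] at hζ
      rw [norm_inv]
      exact inv_anti₀ (by positivity) (h2 ζ hζ).le) (z := 0)
    (subset_closure (mem_ball_self hr))
  simp only [zero_smul, add_zero, norm_inv] at this
  have hx0 : 0 < ‖δ x‖ := norm_pos_iff.2 (by simpa using hnz 0 (mem_closedBall_self hr.le))
  rw [inv_le_inv₀ hx0 (by positivity)] at this
  linarith

end Osg


section Osg
variable {E F : Type} [NormedAddCommGroup E] [NormedSpace ℂ E] [FiniteDimensional ℂ E]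
  [NormedAddCommGroup F] [NormedSpace ℂ F] [FiniteDimensional ℂ F]

/-- iterated directional derivative -/
def osgG (δ : E → ℂ) (v : E) : ℕ → E → ℂ
  | 0 => δ
  | j + 1 => fun z => fderiv ℂ (osgG δ v j) z v

theorem osgG_diff {δ : E → ℂ} {U : Set E} (hU : IsOpen U) (hδ : DifferentiableOn ℂ δ U)
    (v : E) (j : ℕ) : DifferentiableOn ℂ (osgG δ v j) U := by
  induction j with
  | zero => exact hδ
  | succ j ih => exact osg_fderiv_apply hU ih v

theorem osgG_iter {δ : E → ℂ} {U : Set E} (hU : IsOpen U) (hδ : DifferentiableOn ℂ δ U)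
    (a v : E) (j : ℕ) : ∀ ζ : ℂ, a + ζ • v ∈ U →
      iteratedDeriv j (fun ζ : ℂ => δ (a + ζ • v)) ζ = osgG δ v j (a + ζ • v) := by
  induction j with
  | zero => intro ζ _; simp [osgG]
  | succ j ih =>
    intro ζ hζ
    rw [iteratedDeriv_succ]
    have hT : ∀ᶠ ξ : ℂ in 𝓝 ζ, a + ξ • v ∈ U := by
      have hline : Continuous fun ζ : ℂ => a + ζ • v := by fun_prop
      exact hline.tendsto ζ (hU.mem_nhds hζ)
    have : iteratedDeriv j (fun ζ : ℂ => δ (a + ζ • v)) =ᶠ[𝓝 ζ]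
        fun ζ => osgG δ v j (a + ζ • v) := by
      filter_upwards [hT] with ξ hξ using ih ξ hξ
    rw [this.deriv_eq]
    exact (osg_line_deriv ((osgG_diff hU hδ v j).differentiableAt (hU.mem_nhds hζ))).deriv

theorem osg_case0 (h2 : 2 ≤ Module.finrank ℂ E) {f : E → F} {δ : E → ℂ} {a : E} {R : ℝ}
    (hR : 0 < R) (hf : DifferentiableOn ℂ f (ball a R)) (hδ : DifferentiableOn ℂ δ (ball a R))
    (hinj : InjOn f (ball a R)) (hδa : δ a = 0)
    (hZ : ∀ z ∈ ball a R, δ z = 0 → fderiv ℂ f z = 0) : False := by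
  have hUo : IsOpen (ball a R) := isOpen_ball
  have haU : a ∈ ball a R := mem_ball_self hR
  have hnt : Nontrivial E := Module.nontrivial_of_finrank_pos (R := ℂ) (by omega)
  by_cases hall : ∀ z ∈ ball a R, δ z = 0
  · obtain ⟨u, hu⟩ := exists_ne (0 : E)
    obtain ⟨c, hc⟩ := hUo.exists_is_const_of_fderiv_eq_zero (convex_ball a R).isPreconnected hf
      (fun z hz => hZ z hz (hall z hz))
    have hline : Continuous fun ζ : ℂ => a + ζ • u := by fun_prop
    have hT : ∀ᶠ ζ : ℂ in 𝓝[≠] 0, a + ζ • u ∈ ball a R :=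
      mem_nhdsWithin_of_mem_nhds (hline.tendsto 0 (by simpa using hUo.mem_nhds haU))
    obtain ⟨ζ, hζ, hζ0⟩ := (hT.and self_mem_nhdsWithin).exists
    have := hinj hζ haU ((hc _ hζ).trans (hc _ haU).symm)
    simp at this
    exact this.elim hζ0 hu
  push Not at hall
  obtain ⟨b, hb, hδb⟩ := hall
  set v := b - a with hv
  have hv0 : v ≠ 0 := by
    intro h
    rw [hv, sub_eq_zero] at h
    rw [h] at hδb; exact hδb hδa
  have hvpos : 0 < ‖v‖ := norm_pos_iff.2 hv0
  -- some directional derivative at `a` is nonzero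
  have hex : ∃ j, osgG δ v j a ≠ 0 := by
    by_contra hcon
    push Not at hcon
    have hin : ∀ ζ ∈ ball (0:ℂ) (R / ‖v‖), a + ζ • v ∈ ball a R := by
      intro ζ hζ
      rw [mem_ball_zero_iff, lt_div_iff₀ hvpos] at hζ
      simpa [mem_ball, dist_eq_norm, norm_smul] using hζ
    have hd : DifferentiableOn ℂ (fun ζ : ℂ => δ (a + ζ • v)) (ball (0:ℂ) (R / ‖v‖)) := fun ζ hζ =>
      (osg_line_deriv (hδ.differentiableAt
        (hUo.mem_nhds (hin ζ hζ)))).differentiableAt.differentiableWithinAt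
    have h1 : (1:ℂ) ∈ ball (0:ℂ) (R / ‖v‖) := by
      rw [mem_ball_zero_iff, norm_one, lt_div_iff₀ hvpos, one_mul, hv, ← dist_eq_norm]
      exact hb
    have := Complex.taylorSeries_eq_on_ball hd h1
    rw [tsum_congr (g := fun _ => (0:ℂ))] at this
    · simp only [tsum_zero, one_smul] at this
      apply hδb
      rw [this]; congr 1; rw [hv]; abel
    · intro j
      rw [osgG_iter hUo hδ a v j 0 (by simpa using haU)]
      simp [hcon j]
  have hex2 : ∃ j, ∃ z ∈ ball a R, δ z = 0 ∧ osgG δ v j z ≠ 0 := by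
    obtain ⟨j, hj⟩ := hex
    exact ⟨j, a, haU, hδa, hj⟩
  classical
  obtain ⟨a', ha', hδa', hne⟩ := Nat.find_spec hex2
  have hminimal := fun j => Nat.find_min hex2 (m := j)
  set k := Nat.find hex2
  clear_value k
  obtain _ | k := k
  · exact hne hδa'
  set h := osgG δ v k with hh
  have hhZ : ∀ z ∈ ball a R, δ z = 0 → h z = 0 := by
    intro z hz hz0
    by_contra hc
    exact hminimal k (Nat.lt_succ_self k) ⟨z, hz, hz0, hc⟩
  have hhd : DifferentiableOn ℂ h (ball a R) := osgG_diff hUo hδ v k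
  set L := fderiv ℂ h a' with hL
  have hLv : L v ≠ 0 := hne
  have hstrict : HasStrictFDerivAt h L a' :=
    ((osg_contDiffOn hUo 1 ℂ h hhd).contDiffAt (hUo.mem_nhds ha')).hasStrictFDerivAt (by simp)
  -- choose w in the kernel
  obtain ⟨w, hw0, hLw⟩ : ∃ w : E, w ≠ 0 ∧ L w = 0 := by
    have hlt : Module.finrank ℂ ℂ < Module.finrank ℂ E := by
      rw [Module.finrank_self]; omega
    have := LinearMap.ker_ne_bot_of_finrank_lt (f := (L : E →ₗ[ℂ] ℂ)) hlt
    obtain ⟨w, hw, hw0⟩ := (Submodule.ne_bot_iff _).1 this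
    exact ⟨w, hw0, hw⟩
  -- isolated zero
  have hline : Continuous fun ζ : ℂ => a' + ζ • v := by fun_prop
  have hiso : ∀ᶠ ζ : ℂ in 𝓝[≠] 0, δ (a' + ζ • v) ≠ 0 := by
    have hd : HasDerivAt (fun ζ : ℂ => h (a' + ζ • v)) (L v) 0 := by
      have := osg_line_deriv (f := h) (z := a') (u := v) (c := 0)
        (by simpa using hhd.differentiableAt (hUo.mem_nhds ha'))
      simpa using this
    have h3 := hd.eventually_ne hLv (c := 0)
    have hT : ∀ᶠ ζ : ℂ in 𝓝[≠] 0, a' + ζ • v ∈ ball a R :=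
      mem_nhdsWithin_of_mem_nhds (hline.tendsto 0 (by simpa using hUo.mem_nhds ha'))
    filter_upwards [h3, hT] with ζ hζ1 hζ2 hζ3
    exact hζ1 (hhZ _ hζ2 hζ3)
  -- Lipschitz estimate
  set c := ‖L v‖ with hc
  have hcpos : 0 < c := norm_pos_iff.2 hLv
  set ε := c / (2 * ‖v‖) with hε
  have hεpos : 0 < ε := by positivity
  have hest := (hstrict.isLittleO.def hεpos)
  obtain ⟨N, hN, hNest⟩ : ∃ N ∈ 𝓝 a', ∀ x ∈ N, ∀ y ∈ N,
      ‖h x - h y - L (x - y)‖ ≤ ε * ‖x - y‖ := by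
    rw [nhds_prod_eq] at hest
    obtain ⟨N, hN, hsub⟩ := Filter.mem_prod_same_iff.1 hest
    exact ⟨N, hN, fun x hx y hy => hsub (mk_mem_prod hx hy)⟩
  -- choose small params
  have hcont2 : Continuous fun p : ℂ × ℂ => a' + p.1 • w + p.2 • v := by fun_prop
  have hNU : ∀ᶠ p : ℂ × ℂ in 𝓝 ((0:ℂ), (0:ℂ)), a' + p.1 • w + p.2 • v ∈ N ∩ ball a R :=
    hcont2.tendsto ((0:ℂ), (0:ℂ)) (by simpa using ⟨hN, hUo.mem_nhds ha'⟩)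
  obtain ⟨ε1, hε1, hball⟩ := Metric.eventually_nhds_iff_ball.1 hNU
  have hhur := osg_hurwitz hUo hδ ha' hδa' hiso hε1
  have hcw : Continuous fun η : ℂ => a' + η • w := by fun_prop
  have hhur2 : ∀ᶠ η : ℂ in 𝓝 0, ∃ ζ : ℂ, ‖ζ‖ < ε1 ∧ δ (a' + η • w + ζ • v) = 0 :=
    (hcw.tendsto 0).eventually (by simpa using hhur)
  obtain ⟨ρ0, hρ0, hhur3⟩ := Metric.eventually_nhds_iff_ball.1 hhur2
  set ρ := min ρ0 ε1 with hρdef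
  have hρ : 0 < ρ := lt_min hρ0 hε1
  have hchoose : ∀ η : ℂ, ∃ ζ : ℂ, η ∈ ball (0:ℂ) ρ → ‖ζ‖ < ε1 ∧ δ (a' + η • w + ζ • v) = 0 := by
    intro η
    by_cases hη : η ∈ ball (0:ℂ) ρ
    · obtain ⟨ζ, hζ⟩ := hhur3 η (ball_subset_ball (min_le_left _ _) hη)
      exact ⟨ζ, fun _ => hζ⟩
    · exact ⟨0, fun h => absurd h hη⟩
  choose s hs using hchoose
  set γ : ℂ → E := fun η => a' + η • w + s η • v with hγ
  have hγmem : ∀ η ∈ ball (0:ℂ) ρ, γ η ∈ N ∩ ball a R := by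
    intro η hη
    refine hball (η, s η) ?_
    rw [mem_ball_zero_iff] at hη
    rw [← Prod.zero_eq_mk, mem_ball_zero_iff, Prod.norm_def]
    exact max_lt (hη.trans_le (min_le_right _ _)) (hs η (mem_ball_zero_iff.2 hη)).1
  have hγZ : ∀ η ∈ ball (0:ℂ) ρ, δ (γ η) = 0 := fun η hη => (hs η hη).2
  have hdiffγ : ∀ η η', γ η - γ η' = (η - η') • w + (s η - s η') • v := by
    intro η η'; simp only [hγ, sub_smul]; abel
  have hLγ : ∀ η η', L (γ η - γ η') = (s η - s η') * L v := by
    intro η η'; rw [hdiffγ, map_add, map_smul, map_smul, hLw]; simp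
  have hlipS : ∀ η ∈ ball (0:ℂ) ρ, ∀ η' ∈ ball (0:ℂ) ρ,
      ‖s η - s η'‖ * c ≤ 2 * ε * ‖w‖ * ‖η - η'‖ := by
    intro η hη η' hη'
    have h3 := hNest _ (hγmem η hη).1 _ (hγmem η' hη').1
    rw [hhZ _ (hγmem η hη).2 (hγZ η hη), hhZ _ (hγmem η' hη').2 (hγZ η' hη'), hLγ] at h3
    simp only [sub_self, zero_sub, norm_neg, norm_mul] at h3
    have h4 : ‖γ η - γ η'‖ ≤ ‖η - η'‖ * ‖w‖ + ‖s η - s η'‖ * ‖v‖ := by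
      rw [hdiffγ, ← norm_smul, ← norm_smul]; exact norm_add_le _ _
    have h5 : ε * ‖γ η - γ η'‖ ≤ ε * (‖η - η'‖ * ‖w‖ + ‖s η - s η'‖ * ‖v‖) := by gcongr
    have h6 : ε * (‖s η - s η'‖ * ‖v‖) = ‖s η - s η'‖ * c / 2 := by rw [hε]; field_simp
    nlinarith
  set C := ‖w‖ + 2 * ε * ‖w‖ / c * ‖v‖ with hC
  have hlip : ∀ η ∈ ball (0:ℂ) ρ, ∀ η' ∈ ball (0:ℂ) ρ, ‖γ η - γ η'‖ ≤ C * ‖η - η'‖ := by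
    intro η hη η' hη'
    have h3 := hlipS η hη η' hη'
    rw [← le_div_iff₀ hcpos] at h3
    have h4 : ‖γ η - γ η'‖ ≤ ‖η - η'‖ * ‖w‖ + ‖s η - s η'‖ * ‖v‖ := by
      rw [hdiffγ, ← norm_smul, ← norm_smul]; exact norm_add_le _ _
    calc ‖γ η - γ η'‖ ≤ ‖η - η'‖ * ‖w‖ + ‖s η - s η'‖ * ‖v‖ := h4
      _ ≤ ‖η - η'‖ * ‖w‖ + (2 * ε * ‖w‖ * ‖η - η'‖ / c) * ‖v‖ := by gcongr
      _ = C * ‖η - η'‖ := by rw [hC]; ring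
  -- derivative of f ∘ γ vanishes
  have hder : ∀ η ∈ ball (0:ℂ) ρ, HasDerivAt (f ∘ γ) 0 η := by
    intro η hη
    have hbnear : ∀ᶠ η' in 𝓝 η, η' ∈ ball (0:ℂ) ρ := isOpen_ball.mem_nhds hη
    have hO : (fun η' => γ η' - γ η) =O[𝓝 η] fun η' => η' - η := by
      refine Asymptotics.IsBigO.of_bound C ?_
      filter_upwards [hbnear] with η' hη' using hlip η' hη' η hη
    have htend : Tendsto γ (𝓝 η) (𝓝 (γ η)) := by
      have h0 : Tendsto (fun η' : ℂ => η' - η) (𝓝 η) (𝓝 0) := by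
        have : Continuous fun η' : ℂ => η' - η := by fun_prop
        simpa using this.tendsto η
      have := hO.trans_tendsto h0
      simpa using this.add_const (γ η)
    have hfd := (hf.differentiableAt (hUo.mem_nhds (hγmem η hη).2)).hasFDerivAt
    rw [hZ _ (hγmem η hη).2 (hγZ η hη)] at hfd
    have ho := hfd.isLittleO.comp_tendsto htend
    rw [hasDerivAt_iff_isLittleO]
    have := ho.trans_isBigO hO
    simpa [Function.comp_def] using this
  have h0 : (0:ℂ) ∈ ball (0:ℂ) ρ := mem_ball_self hρ
  have h1 : ((ρ / 2 : ℝ) : ℂ) ∈ ball (0:ℂ) ρ := by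
    rw [mem_ball_zero_iff, Complex.norm_real, Real.norm_of_nonneg (by positivity)]; linarith
  have heq : f (γ 0) = f (γ ((ρ / 2 : ℝ) : ℂ)) :=
    isOpen_ball.is_const_of_deriv_eq_zero (convex_ball (0:ℂ) ρ).isPreconnected
      (f := f ∘ γ) (fun η hη => (hder η hη).differentiableAt.differentiableWithinAt)
      (fun η hη => (hder η hη).deriv) h0 h1
  have hγeq := hinj (hγmem _ h0).2 (hγmem _ h1).2 heq
  have hγ0 := sub_eq_zero.2 hγeq
  have hs0 := hLγ 0 ((ρ / 2 : ℝ) : ℂ)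
  rw [hγ0, map_zero, eq_comm, mul_eq_zero] at hs0
  have hs1 := hs0.resolve_right hLv
  rw [hdiffγ, hs1, zero_smul, add_zero, smul_eq_zero] at hγ0
  have := hγ0.resolve_right hw0
  simp at this
  exact hρ.ne' this

end Osg


def OsgP (n : ℕ) : Prop := ∀ (E F : Type) [NormedAddCommGroup E] [NormedSpace ℂ E]
    [FiniteDimensional ℂ E] [NormedAddCommGroup F] [NormedSpace ℂ F] [FiniteDimensional ℂ F],
    Module.finrank ℂ E = n → Module.finrank ℂ F = n → ∀ (f : E → F) (U : Set E), IsOpen U →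
    DifferentiableOn ℂ f U → InjOn f U → ∀ a ∈ U, Function.Injective (fderiv ℂ f a)

section Osg
variable {E F : Type} [NormedAddCommGroup E] [NormedSpace ℂ E] [FiniteDimensional ℂ E]
  [NormedAddCommGroup F] [NormedSpace ℂ F] [FiniteDimensional ℂ F]

theorem osg_reduce {n : ℕ} (ih : OsgP n) (hE : Module.finrank ℂ E = n + 1)
    (hF : Module.finrank ℂ F = n + 1) {f : E → F} {U : Set E} (hU : IsOpen U)
    (hf : DifferentiableOn ℂ f U) (hinj : InjOn f U) {a : E} (ha : a ∈ U)
    (hne : fderiv ℂ f a ≠ 0) : Function.Injective (fderiv ℂ f a) := by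
  have : CompleteSpace E := FiniteDimensional.complete ℂ E
  set D := fderiv ℂ f a with hD
  obtain ⟨u0, hu0⟩ : ∃ u, D u ≠ 0 := by
    by_contra hc
    push Not at hc
    exact hne (ContinuousLinearMap.ext hc)
  obtain ⟨l, hl⟩ := SeparatingDual.exists_eq_one (R := ℂ) hu0
  set A : E →L[ℂ] ℂ := l.comp D with hA
  have hAu : A u0 = 1 := hl
  have hfa := (hf.differentiableAt (hU.mem_nhds ha)).hasFDerivAt
  have hfc : ContDiffAt ℂ 1 f a := (osg_contDiffOn hU 1 F f hf).contDiffAt (hU.mem_nhds ha)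
  set Φ : E → E := fun x => x + (l (f x) - l (f a) - A (x - a)) • u0 with hΦ
  have hΦc : ContDiffAt ℂ 1 Φ a := by
    have h1 : ContDiffAt ℂ 1 (fun x => l (f x)) a := l.contDiff.contDiffAt.comp a hfc
    have h2 : ContDiffAt ℂ 1 (fun x => A (x - a)) a :=
      A.contDiff.contDiffAt.comp a (contDiffAt_id.sub contDiffAt_const)
    exact contDiffAt_id.add (((h1.sub contDiffAt_const).sub h2).smul contDiffAt_const)
  have hΦd : HasFDerivAt Φ ((ContinuousLinearEquiv.refl ℂ E : E ≃L[ℂ] E) : E →L[ℂ] E) a := by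
    have h1 : HasFDerivAt (fun x => l (f x)) A a := l.hasFDerivAt.comp a hfa
    have h2 : HasFDerivAt (fun x => A (x - a)) A a := by
      have h := A.hasFDerivAt.comp a ((hasFDerivAt_id a).sub_const a)
      rw [ContinuousLinearMap.comp_id] at h
      exact h
    have h3 := (hasFDerivAt_id (𝕜 := ℂ) a).add
      ((((h1.sub_const (l (f a))).sub h2)).smul_const u0)
    have h4 : HasFDerivAt Φ (ContinuousLinearMap.id ℂ E + (A - A).smulRight u0) a := h3
    have h5 : ((ContinuousLinearEquiv.refl ℂ E : E ≃L[ℂ] E) : E →L[ℂ] E)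
        = ContinuousLinearMap.id ℂ E + (A - A).smulRight u0 := by ext x; simp
    rw [h5]; exact h4
  have hΦa : Φ a = a := by simp [hΦ]
  have hAΦ : ∀ x, A (Φ x - a) = l (f x) - l (f a) := by
    intro x
    have : Φ x - a = (x - a) + (l (f x) - l (f a) - A (x - a)) • u0 := by
      simp only [hΦ]; abel
    rw [this, map_add, map_smul, hAu]; simp
  have hst := hΦc.hasStrictFDerivAt' hΦd (by simp)
  set Ψ := hst.localInverse Φ _ a with hΨ
  have hΨc : ContDiffAt ℂ 1 Ψ a := by
    have := hΦc.to_localInverse hΦd (by simp)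
    rwa [hΦa] at this
  have hΨd : HasFDerivAt Ψ (ContinuousLinearMap.id ℂ E) a := by
    have := hst.to_localInverse.hasFDerivAt
    rw [hΦa] at this
    exact this
  have hΨa : Ψ a = a := by
    have := hst.localInverse_apply_image
    rwa [hΦa] at this
  have e1 : ∀ᶠ y in 𝓝 a, Φ (Ψ y) = y := by
    have := hst.eventually_right_inverse
    rwa [hΦa] at this
  have e2 : ∀ᶠ y in 𝓝 a, Ψ y ∈ U :=
    hΨc.continuousAt.eventually (by rw [hΨa]; exact hU.mem_nhds ha)
  have e3 : ∀ᶠ y in 𝓝 a, DifferentiableAt ℂ Ψ y := by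
    filter_upwards [hΨc.eventually (by simp)] with y hy using hy.differentiableAt (by simp)
  obtain ⟨V, hVsub, hVo, haV⟩ := _root_.mem_nhds_iff.1 (e1.and (e2.and e3))
  set K := LinearMap.ker (A : E →ₗ[ℂ] ℂ) with hK
  set M := LinearMap.ker (l : F →ₗ[ℂ] ℂ) with hM
  have hKn : Module.finrank ℂ K = n := by
    have h0 : (A : E →ₗ[ℂ] ℂ) ≠ 0 := fun h => by
      have := LinearMap.congr_fun h u0
      simp [hAu] at this
    have := Module.Dual.finrank_ker_add_one_of_ne_zero (K := ℂ) (V₁ := E) (f := (A : E →ₗ[ℂ] ℂ)) h0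
    change Module.finrank ℂ K + 1 = _ at this
    omega
  have hMn : Module.finrank ℂ M = n := by
    have h0 : (l : F →ₗ[ℂ] ℂ) ≠ 0 := fun h => by
      have := LinearMap.congr_fun h (D u0)
      simp [hl] at this
    have := Module.Dual.finrank_ker_add_one_of_ne_zero (K := ℂ) (V₁ := F) (f := (l : F →ₗ[ℂ] ℂ)) h0
    change Module.finrank ℂ M + 1 = _ at this
    omega
  let π : F →L[ℂ] M := (ContinuousLinearMap.id ℂ F - l.smulRight (D u0)).codRestrict M (by
    intro y
    change l (y - l y • D u0) = 0
    rw [map_sub, map_smul, hl]; simp)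
  have hπ : ∀ y, l y = 0 → (π y : F) = y := by
    intro y hy
    change y - l y • D u0 = y
    rw [hy]; simp
  set φ : K → M := fun k => π (f (Ψ (a + (k : E))) - f a) with hφ
  have hVK : IsOpen {k : K | a + (k : E) ∈ V} := hVo.preimage (by fun_prop)
  have hd : ∀ k : K, a + (k : E) ∈ V → HasFDerivAt φ
      (π.comp ((fderiv ℂ f (Ψ (a + (k : E)))).comp ((fderiv ℂ Ψ (a + (k : E))).comp K.subtypeL))) k := by
    intro k hk
    obtain ⟨-, h2, h3⟩ := hVsub hk
    have g1 : HasFDerivAt (fun k : K => a + (k : E)) K.subtypeL k :=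
      (K.subtypeL.hasFDerivAt (x := k)).const_add a
    have g2 := h3.hasFDerivAt.comp k g1
    have g3 := (hf.differentiableAt (hU.mem_nhds h2)).hasFDerivAt.comp k g2
    exact π.hasFDerivAt.comp k (g3.sub_const (f a))
  have hval : ∀ k : K, a + (k : E) ∈ V → (φ k : F) = f (Ψ (a + (k : E))) - f a := by
    intro k hk
    obtain ⟨h1, -, -⟩ := hVsub hk
    apply hπ
    rw [map_sub, ← hAΦ, h1]
    simp
  have hφinj : InjOn φ {k : K | a + (k : E) ∈ V} := by
    intro k hk k' hk' heq
    have h1 : (φ k : F) = φ k' := by rw [heq]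
    rw [hval k hk, hval k' hk'] at h1
    have h2 := hinj (hVsub hk).2.1 (hVsub hk').2.1 (sub_left_injective h1)
    have h3 : Φ (Ψ (a + (k : E))) = Φ (Ψ (a + (k' : E))) := by rw [h2]
    rw [(hVsub hk).1, (hVsub hk').1] at h3
    exact Subtype.ext (add_left_cancel h3)
  have h0V : a + ((0 : K) : E) ∈ V := by simpa using haV
  have hI := ih K M hKn hMn φ _ hVK
    (fun k hk => (hd k hk).differentiableAt.differentiableWithinAt) hφinj 0 h0V
  rw [(hd 0 h0V).fderiv] at hI
  rw [injective_iff_map_eq_zero]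
  intro x hx
  have hxK : x ∈ K := by
    change l (D x) = 0
    rw [hx, map_zero]
  have := (injective_iff_map_eq_zero _).1 hI ⟨x, hxK⟩ (by
    simp only [Submodule.coe_zero, add_zero, hΨa, hΨd.fderiv]
    change π (D x) = 0
    rw [hx, map_zero])
  exact congrArg Subtype.val this

theorem osg_base (hE : Module.finrank ℂ E = 1)
    (hF : Module.finrank ℂ F = 1) {f : E → F} {U : Set E} (hU : IsOpen U)
    (hf : DifferentiableOn ℂ f U) (hinj : InjOn f U) {a : E} (ha : a ∈ U) :
    fderiv ℂ f a ≠ 0 := by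
  intro hzero
  have hnt : Nontrivial E := Module.nontrivial_of_finrank_pos (R := ℂ) (by omega)
  obtain ⟨u, hu⟩ := exists_ne (0 : E)
  let e : F ≃L[ℂ] ℂ := ContinuousLinearEquiv.ofFinrankEq (by rw [hF, Module.finrank_self])
  have hline : Continuous fun ζ : ℂ => a + ζ • u := by fun_prop
  have hTo : IsOpen {ζ : ℂ | a + ζ • u ∈ U} := hU.preimage hline
  have h0 : (0:ℂ) ∈ {ζ : ℂ | a + ζ • u ∈ U} := by simpa using ha
  have hd : ∀ ζ ∈ {ζ : ℂ | a + ζ • u ∈ U}, HasDerivAt (fun ζ : ℂ => e (f (a + ζ • u)))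
      (e (fderiv ℂ f (a + ζ • u) u)) ζ := fun ζ hζ =>
    e.toContinuousLinearMap.hasFDerivAt.comp_hasDerivAt ζ
      (osg_line_deriv (hf.differentiableAt (hU.mem_nhds hζ)))
  have han : AnalyticAt ℂ (fun ζ : ℂ => e (f (a + ζ • u))) 0 :=
    DifferentiableOn.analyticAt
      (fun ζ hζ => (hd ζ hζ).differentiableAt.differentiableWithinAt) (hTo.mem_nhds h0)
  refine osg_one han (hTo.mem_nhds h0) ?_ ?_
  · intro ζ hζ ζ' hζ' heq
    have h1 := hinj hζ hζ' (e.injective heq)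
    exact smul_left_injective ℂ hu (add_left_cancel h1)
  · rw [(hd 0 h0).deriv]
    simp [hzero]

end Osg

theorem osg_prod_diff {E : Type} [NormedAddCommGroup E] [NormedSpace ℂ E] {m : ℕ} {U : Set E}
    (g : Fin m → E → ℂ) (s : Finset (Fin m)) (h : ∀ i, DifferentiableOn ℂ (g i) U) :
    DifferentiableOn ℂ (fun z => ∏ i ∈ s, g i z) U := by
  induction s using Finset.induction_on with
  | empty => simp
  | insert i s hi ih =>
    simp only [Finset.prod_insert hi]
    exact (h i).fun_mul ih

theorem osg_main (n : ℕ) : OsgP n := by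
  induction n with
  | zero =>
    intro E F _ _ _ _ _ _ hE hF f U hU hf hinj a ha
    have : Subsingleton E := Module.finrank_zero_iff.1 hE
    exact Function.injective_of_subsingleton _
  | succ n ih =>
    intro E F _ _ _ _ _ _ hE hF f U hU hf hinj a ha
    by_cases hz : fderiv ℂ f a ≠ 0
    · exact osg_reduce ih hE hF hU hf hinj ha hz
    exfalso
    push Not at hz
    rcases Nat.eq_zero_or_pos n with rfl | hn
    · exact osg_base (by simpa using hE) (by simpa using hF) hU hf hinj ha hz
    obtain ⟨R, hR, hsub⟩ := Metric.isOpen_iff.1 hU a ha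
    let b := Module.finBasisOfFinrankEq ℂ E hE
    let c := Module.finBasisOfFinrankEq ℂ F hF
    have hfB := hf.mono hsub
    refine osg_case0 (f := f) (a := a) (R := R)
      (δ := fun z => (LinearMap.toMatrix b c (fderiv ℂ f z : E →ₗ[ℂ] F)).det)
      (by omega) hR hfB ?_ (hinj.mono hsub) ?_ ?_
    · simp only [Matrix.det_apply]
      refine DifferentiableOn.fun_sum fun σ _ => ?_
      refine DifferentiableOn.const_smul ?_ _
      refine osg_prod_diff _ _ fun i => ?_
      simp only [LinearMap.toMatrix_apply]
      exact (LinearMap.toContinuousLinearMap (c.coord (σ i))).differentiable.comp_differentiableOn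
        (osg_fderiv_apply isOpen_ball hfB (b i))
    · simp only [hz]
      simp
    · intro z hzB hdet
      by_contra hne
      have hI := osg_reduce ih hE hF hU hf hinj (hsub hzB) hne
      let e := LinearEquiv.ofInjectiveOfFinrankEq (fderiv ℂ f z : E →ₗ[ℂ] F) hI (hE.trans hF.symm)
      have hu := LinearEquiv.isUnit_det e b c
      have he : (e : E →ₗ[ℂ] F) = (fderiv ℂ f z : E →ₗ[ℂ] F) := by ext; rfl
      rw [he, hdet] at hu
      simp at hu


theorem osg_inv {E : Type} [NormedAddCommGroup E] [NormedSpace ℂ E] [FiniteDimensional ℂ E]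
    {f : E → E} {U : Set E} (hU : IsOpen U) (hf : DifferentiableOn ℂ f U) (hinj : InjOn f U) :
    DifferentiableOn ℂ (Function.invFunOn f U) (f '' U) := by
  have : CompleteSpace E := FiniteDimensional.complete ℂ E
  rintro _ ⟨a, ha, rfl⟩
  apply DifferentiableAt.differentiableWithinAt
  have hI := osg_main (Module.finrank ℂ E) E E rfl rfl f U hU hf hinj a ha
  have hfc : ContDiffAt ℂ 1 f a := (osg_contDiffOn hU 1 E f hf).contDiffAt (hU.mem_nhds ha)
  let e : E ≃L[ℂ] E := (LinearEquiv.ofInjectiveOfFinrankEq (fderiv ℂ f a : E →ₗ[ℂ] E) hI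
    rfl).toContinuousLinearEquiv
  have he : (e : E →L[ℂ] E) = fderiv ℂ f a := by ext x; rfl
  have hst : HasStrictFDerivAt f (e : E →L[ℂ] E) a := by
    rw [he]; exact hfc.hasStrictFDerivAt (by simp)
  have h1 := hst.to_localInverse.hasFDerivAt.differentiableAt
  refine h1.congr_of_eventuallyEq ?_
  have h2 : ∀ᶠ y in 𝓝 (f a), hst.localInverse f _ a y ∈ U :=
    h1.continuousAt.eventually (by
      rw [hst.localInverse_apply_image]; exact hU.mem_nhds ha)
  filter_upwards [h2, hst.eventually_right_inverse] with y hy hy'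
  have hmem : ∃ x ∈ U, f x = y := ⟨_, hy, hy'⟩
  exact hinj (Function.invFunOn_mem hmem) hy ((Function.invFunOn_eq hmem).trans hy'.symm)

theorem IsPolyMap.zero (n : ℕ) : IsPolyMap n 0 := ⟨fun _ => 0, by simp⟩

theorem IsPolyMap.add {n : ℕ} {p q : En n → En n} (hp : IsPolyMap n p) (hq : IsPolyMap n q) :
    IsPolyMap n (fun z => p z + q z) := by
  obtain ⟨P, hP⟩ := hp
  obtain ⟨Q, hQ⟩ := hq
  exact ⟨fun i => P i + Q i, fun z i => by simp [hP, hQ]⟩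

theorem IsPolyMap.sum {n : ℕ} {ι : Type} (s : Finset ι) {p : ι → En n → En n}
    (hp : ∀ i, IsPolyMap n (p i)) : IsPolyMap n (fun z => ∑ i ∈ s, p i z) := by
  classical
  induction s using Finset.induction_on with
  | empty =>
    simp only [Finset.sum_empty]
    exact IsPolyMap.zero n
  | insert i s hi ih =>
    simp only [Finset.sum_insert hi]
    exact (hp i).add ih

theorem IsPolyMap.const_smul {n : ℕ} {p : En n → En n} (c : ℂ) (hp : IsPolyMap n p) :
    IsPolyMap n (fun z => c • p z) := by
  obtain ⟨P, hP⟩ := hp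
  exact ⟨fun i => MvPolynomial.C c * P i, fun z i => by simp [hP]⟩

theorem IsPolyMap.multilinear {n k : ℕ}
    (L : ContinuousMultilinearMap ℂ (fun _ : Fin k => En n) (En n)) :
    IsPolyMap n (fun z => L (fun _ => z)) := by
  have h : (fun z : En n => L (fun _ => z)) = fun z => ∑ r : Fin k → Fin n,
      (∏ i, z (r i)) • L (fun i => EuclideanSpace.single (r i) (1 : ℂ)) := by
    funext z
    have hz : z = ∑ j, z j • EuclideanSpace.single j (1 : ℂ) := by
      ext i
      simp [Finset.sum_apply, Pi.single_apply]
    have h1 : L (fun _ => z) = L.toMultilinearMap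
        (fun _ => ∑ j, z j • EuclideanSpace.single j (1 : ℂ)) := by
      rw [← hz]; rfl
    rw [h1, MultilinearMap.map_sum]
    refine Finset.sum_congr rfl fun r _ => ?_
    rw [MultilinearMap.map_smul_univ]
    rfl
  rw [h]
  refine IsPolyMap.sum _ fun r => ?_
  refine ⟨fun m => (∏ i, MvPolynomial.X (r i)) *
    MvPolynomial.C ((L (fun i => EuclideanSpace.single (r i) (1 : ℂ))) m), fun z m => ?_⟩
  simp [map_prod]

theorem IsPolyMap.comp {n : ℕ} {p q : En n → En n} (hp : IsPolyMap n p) (hq : IsPolyMap n q) :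
    IsPolyMap n (p ∘ q) := by
  obtain ⟨P, hP⟩ := hp
  obtain ⟨Q, hQ⟩ := hq
  refine ⟨fun i => MvPolynomial.bind₁ Q (P i), fun z i => ?_⟩
  have h1 : (fun j => q z j) = fun j => MvPolynomial.eval (fun j => z j) (Q j) := by
    funext j; rw [hQ]
  have h2 := MvPolynomial.aeval_bind₁ (R := ℂ) (fun j => z j) Q (P i)
  rw [Function.comp_apply, hP, h1]
  exact h2.symm

theorem IsPolyMap.continuous {n : ℕ} {p : En n → En n} (hp : IsPolyMap n p) : Continuous p := by
  obtain ⟨P, hP⟩ := hp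
  have : p = fun z => WithLp.toLp 2 (fun i => MvPolynomial.eval (fun j => z j) (P i)) := by
    funext z; ext i; exact hP z i
  rw [this]
  refine (PiLp.continuous_toLp 2 _).comp (continuous_pi fun i => ?_)
  exact (MvPolynomial.continuous_eval (P i)).comp (by fun_prop)

theorem poly_slice {n : ℕ} {g : En n → En n} (hg : DifferentiableOn ℂ g (Ball n)) (z : En n)
    (k : ℕ) : iteratedDeriv k (fun ζ : ℂ => g (ζ • z)) 0 = iteratedFDeriv ℂ k g 0 (fun _ => z) := by
  have hBo : IsOpen (Ball n) := isOpen_ball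
  let A : ℂ →L[ℂ] En n := (ContinuousLinearMap.id ℂ ℂ).smulRight z
  have h0 : A 0 ∈ Ball n := by simp [Ball]
  have h0' : (0 : En n) ∈ Ball n := by simp [Ball]
  have hpo : IsOpen (A ⁻¹' Ball n) := hBo.preimage A.continuous
  have h := A.iteratedFDerivWithin_comp_right (osg_contDiffOn hBo k (En n) g hg)
    hBo.uniqueDiffOn hpo.uniqueDiffOn h0 (i := k) le_rfl
  rw [iteratedFDerivWithin_of_isOpen k hpo h0, iteratedFDerivWithin_of_isOpen k hBo h0,
    map_zero] at h
  rw [iteratedDeriv_eq_iteratedFDeriv]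
  have h2 := congrArg (fun M => M (fun _ => (1 : ℂ))) h
  have hA1 : A 1 = z := by simp [A]
  simp only [ContinuousMultilinearMap.compContinuousLinearMap_apply, hA1] at h2
  exact h2

theorem poly_approx {n : ℕ} {g : En n → En n} (hg : DifferentiableOn ℂ g (Ball n)) {r : ℝ}
    (hr0 : 0 < r) (hr1 : r < 1) {ε : ℝ} (hε : 0 < ε) :
    ∃ P, IsPolyMap n P ∧ ∀ z : En n, ‖z‖ ≤ r → ‖P z - g z‖ < ε := by
  set ρ := (1 + r) / 2 with hρ
  have hρr : r < ρ := by rw [hρ]; linarith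
  have hρ1 : ρ < 1 := by rw [hρ]; linarith
  set R := ρ / r with hR
  have hR1 : 1 < R := by rw [hR, lt_div_iff₀ hr0]; linarith
  have hR0 : 0 < R := by linarith
  have hRr : R * r = ρ := by rw [hR]; field_simp
  have hsub : closedBall (0 : En n) ρ ⊆ Ball n := closedBall_subset_ball hρ1
  obtain ⟨C, hC⟩ := (isCompact_closedBall (0 : En n) ρ).exists_bound_of_continuousOn
    (hg.continuousOn.mono hsub)
  let T : ℕ → En n → En n := fun k z => ((k.factorial : ℂ))⁻¹ • iteratedFDeriv ℂ k g 0 (fun _ => z)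
  have hsl : ∀ z : En n, ‖z‖ ≤ r → ∀ ζ ∈ closedBall (0 : ℂ) R, ζ • z ∈ closedBall (0 : En n) ρ := by
    intro z hz ζ hζ
    rw [mem_closedBall_zero_iff] at hζ ⊢
    rw [norm_smul, ← hRr]
    gcongr
  have hdiff : ∀ z : En n, ‖z‖ ≤ r →
      DifferentiableOn ℂ (fun ζ : ℂ => g (ζ • z)) (closedBall 0 R) := by
    intro z hz
    exact hg.comp (by fun_prop) fun ζ hζ => hsub (hsl z hz ζ hζ)
  have hsum : ∀ z : En n, ‖z‖ ≤ r → HasSum (fun k => T k z) (g z) := by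
    intro z hz
    have h := Complex.hasSum_taylorSeries_on_ball ((hdiff z hz).mono ball_subset_closedBall)
      (z := 1) (by simpa using hR1)
    simpa [poly_slice hg, T] using h
  have hbound : ∀ k, ∀ z ∈ closedBall (0 : En n) r, ‖T k z‖ ≤ C * (R⁻¹) ^ k := by
    intro k z hz
    rw [mem_closedBall_zero_iff] at hz
    have h := Complex.norm_iteratedDeriv_le_of_forall_mem_sphere_norm_le k hR0
      (c := 0) (f := fun ζ : ℂ => g (ζ • z)) (C := C)
      (DifferentiableOn.diffContOnCl (by rw [closure_ball _ hR0.ne']; exact hdiff z hz))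
      (fun ζ hζ => hC _ (hsl z hz ζ (sphere_subset_closedBall hζ)))
    rw [poly_slice hg] at h
    have hk : (0 : ℝ) < k.factorial := by exact_mod_cast k.factorial_pos
    simp only [T, norm_smul, norm_inv, Complex.norm_natCast]
    rw [inv_mul_le_iff₀ hk]
    calc _ ≤ _ := h
      _ = _ := by rw [inv_pow]; ring
  have hu : Summable fun k : ℕ => C * (R⁻¹) ^ k :=
    (summable_geometric_of_lt_one (by positivity) (inv_lt_one_of_one_lt₀ hR1)).mul_left C
  have ht := tendstoUniformlyOn_tsum_nat hu hbound
  obtain ⟨N, hN⟩ := (Metric.tendstoUniformlyOn_iff.1 ht ε hε).exists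
  refine ⟨fun z => ∑ k ∈ Finset.range N, T k z, IsPolyMap.sum _ fun k =>
    (IsPolyMap.multilinear _).const_smul _, fun z hz => ?_⟩
  have h := hN z (by simpa using hz)
  rw [(hsum z hz).tsum_eq, dist_comm, dist_eq_norm] at h
  exact h

/-- Compact subsets of the unit ball lie in a smaller closed ball. -/
theorem ball_exhaust {n : ℕ} {K : Set (En n)} (hK : IsCompact K) (hsub : K ⊆ Ball n) :
    ∃ r, 0 < r ∧ r < 1 ∧ ∀ z ∈ K, ‖z‖ ≤ r := by
  rcases K.eq_empty_or_nonempty with rfl | hne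
  · exact ⟨1 / 2, by norm_num, by norm_num, by simp⟩
  obtain ⟨w, hw, hmax⟩ := hK.exists_isMaxOn hne continuous_norm.continuousOn
  have hw1 : ‖w‖ < 1 := by simpa [Ball] using hsub hw
  exact ⟨(1 + ‖w‖) / 2, by positivity, by linarith, fun z hz => by
    have : ‖z‖ ≤ ‖w‖ := hmax hz
    linarith⟩

theorem runge_id_to_all {n : ℕ} {f : En n → En n} {p : ℕ → En n → En n}
    (hp : ∀ k, IsPolyMap n (p k))
    (hlim : TendstoLocallyUniformlyOn (fun k => p k ∘ f) id atTop (Ball n))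
    {g : En n → En n} (hg : DifferentiableOn ℂ g (Ball n)) :
    ∃ q : ℕ → En n → En n, (∀ k, IsPolyMap n (q k)) ∧
      TendstoLocallyUniformlyOn (fun k => q k ∘ f) g atTop (Ball n) := by
  have hBo : IsOpen (Ball n) := isOpen_ball
  have key : ∀ j : ℕ, ∃ q, IsPolyMap n q ∧
      ∀ z : En n, ‖z‖ ≤ 1 - 1 / ((j : ℝ) + 2) → ‖q (f z) - g z‖ < 2 / ((j : ℝ) + 1) := by
    intro j
    have hj : (0 : ℝ) ≤ j := Nat.cast_nonneg j
    set r : ℝ := 1 - 1 / ((j : ℝ) + 2) with hr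
    have hr0 : 0 < r := by
      rw [hr, sub_pos, div_lt_one (by linarith)]; linarith
    have hr1 : r < 1 := by
      have : 0 < 1 / ((j : ℝ) + 2) := by positivity
      linarith
    have hε : 0 < 1 / ((j : ℝ) + 1) := by positivity
    obtain ⟨P, hP, hPg⟩ := poly_approx hg hr0 hr1 hε
    have huc := (isCompact_closedBall (0 : En n) 2).uniformContinuousOn_of_continuous
      hP.continuous.continuousOn
    obtain ⟨δ, hδ, hδP⟩ := Metric.uniformContinuousOn_iff.1 huc _ hε
    have hK : TendstoUniformlyOn (fun k => p k ∘ f) id atTop (closedBall (0 : En n) r) :=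
      (tendstoLocallyUniformlyOn_iff_forall_isCompact hBo).1 hlim _
        (closedBall_subset_ball hr1) (isCompact_closedBall _ _)
    obtain ⟨k, hk⟩ := (Metric.tendstoUniformlyOn_iff.1 hK (min δ 1) (lt_min hδ one_pos)).exists
    refine ⟨P ∘ p k, hP.comp (hp k), fun z hz => ?_⟩
    have h1 := hk z (by simpa using hz)
    simp only [id, Function.comp_apply] at h1
    have h2 : ‖p k (f z)‖ ≤ 2 := by
      have : dist z (p k (f z)) < 1 := h1.trans_le (min_le_right _ _)
      rw [dist_eq_norm] at this
      have h3 : ‖p k (f z)‖ ≤ ‖z‖ + ‖z - p k (f z)‖ := by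
        have := norm_sub_le z (z - p k (f z))
        simpa using this
      linarith
    have h3 := hδP z (by simp; linarith) (p k (f z)) (by simpa using h2)
      (h1.trans_le (min_le_left _ _))
    rw [dist_comm, dist_eq_norm] at h3
    calc ‖(P ∘ p k) (f z) - g z‖ = ‖(P (p k (f z)) - P z) + (P z - g z)‖ := by simp
      _ ≤ ‖P (p k (f z)) - P z‖ + ‖P z - g z‖ := norm_add_le _ _
      _ < 1 / ((j : ℝ) + 1) + 1 / ((j : ℝ) + 1) := add_lt_add h3 (hPg z hz)
      _ = 2 / ((j : ℝ) + 1) := by ring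
  choose q hq hqg using key
  refine ⟨q, hq, (tendstoLocallyUniformlyOn_iff_forall_isCompact hBo).2 fun K hKs hK => ?_⟩
  obtain ⟨r, hr0, hr1, hKr⟩ := ball_exhaust hK hKs
  rw [Metric.tendstoUniformlyOn_iff]
  intro ε hε
  have t1 : Tendsto (fun j : ℕ => 2 / ((j : ℝ) + 1)) atTop (𝓝 0) :=
    tendsto_const_nhds.div_atTop (tendsto_atTop_add_const_right _ _ tendsto_natCast_atTop_atTop)
  have t2 : Tendsto (fun j : ℕ => 1 / ((j : ℝ) + 2)) atTop (𝓝 0) :=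
    tendsto_const_nhds.div_atTop (tendsto_atTop_add_const_right _ _ tendsto_natCast_atTop_atTop)
  filter_upwards [t1.eventually_lt_const hε, t2.eventually_lt_const (sub_pos.2 hr1)]
    with j hj1 hj2 z hz
  rw [dist_comm, dist_eq_norm]
  exact (hqg j z ((hKr z hz).trans (by linarith))).trans hj1

end Helpers

/-- Characterizations of univalent maps of 𝔹ₙ onto Runge domains:
(a) f(𝔹ₙ) is Runge; (b) f⁻¹ is a locally uniform limit of polynomial maps on
f(𝔹ₙ); (c) every holomorphic g on 𝔹ₙ is a locally uniform limit of maps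
p_k ∘ f with p_k polynomial. -/
theorem runge_characterizations (n : ℕ) (f : En n → En n) (hf : UnivalentOn n f) :
    (RungeOn n (f '' Ball n) ↔
      ∃ p : ℕ → En n → En n, (∀ k, IsPolyMap n (p k)) ∧
        TendstoLocallyUniformlyOn p (Function.invFunOn f (Ball n)) atTop (f '' Ball n))
    ∧ (RungeOn n (f '' Ball n) ↔
      ∀ g : En n → En n, DifferentiableOn ℂ g (Ball n) →
        ∃ p : ℕ → En n → En n, (∀ k, IsPolyMap n (p k)) ∧
          TendstoLocallyUniformlyOn (fun k => p k ∘ f) g atTop (Ball n)) := by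
  obtain ⟨hfd, hinj⟩ := hf
  have hinv : DifferentiableOn ℂ (Function.invFunOn f (Ball n)) (f '' Ball n) :=
    osg_inv isOpen_ball hfd hinj
  have hmt : MapsTo f (Ball n) (f '' Ball n) := mapsTo_image _ _
  have hmi : MapsTo (Function.invFunOn f (Ball n)) (f '' Ball n) (Ball n) :=
    fun y hy => Function.invFunOn_mem hy
  have hri : ∀ y ∈ f '' Ball n, f (Function.invFunOn f (Ball n) y) = y :=
    fun y hy => Function.invFunOn_eq hy
  have hli : ∀ z ∈ Ball n, Function.invFunOn f (Ball n) (f z) = z :=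
    fun z hz => hinj (hmi (hmt hz)) hz (hri _ (hmt hz))
  have hab : RungeOn n (f '' Ball n) →
      ∃ p : ℕ → En n → En n, (∀ k, IsPolyMap n (p k)) ∧
        TendstoLocallyUniformlyOn p (Function.invFunOn f (Ball n)) atTop (f '' Ball n) :=
    fun h => h _ hinv
  have hbc : (∃ p : ℕ → En n → En n, (∀ k, IsPolyMap n (p k)) ∧
        TendstoLocallyUniformlyOn p (Function.invFunOn f (Ball n)) atTop (f '' Ball n)) →
      ∀ g : En n → En n, DifferentiableOn ℂ g (Ball n) →
        ∃ p : ℕ → En n → En n, (∀ k, IsPolyMap n (p k)) ∧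
          TendstoLocallyUniformlyOn (fun k => p k ∘ f) g atTop (Ball n) := by
    rintro ⟨p, hp, hlim⟩ g hg
    exact runge_id_to_all hp
      ((hlim.comp f hmt hfd.continuousOn).congr_right fun z hz => hli z hz) hg
  have hca : (∀ g : En n → En n, DifferentiableOn ℂ g (Ball n) →
        ∃ p : ℕ → En n → En n, (∀ k, IsPolyMap n (p k)) ∧
          TendstoLocallyUniformlyOn (fun k => p k ∘ f) g atTop (Ball n)) →
      RungeOn n (f '' Ball n) := by
    intro h g hg
    obtain ⟨p, hp, hlim⟩ := h (g ∘ f) (hg.comp hfd hmt)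
    refine ⟨p, hp, ?_⟩
    have h1 := hlim.comp _ hmi hinv.continuousOn
    refine (h1.congr_right (g := g) fun y hy => ?_).congr fun k y hy => ?_
    · simp only [Function.comp_apply, hri y hy]
    · simp only [Function.comp_apply, hri y hy]
  exact ⟨⟨hab, fun h => hca (hbc h)⟩, ⟨fun h => hbc (hab h), hca⟩⟩

end
end

section
/- For every n ≥ 2 there exists an open set D ⊆ ℂⁿ which is biholomorphic to 𝔹ₙ (i.e., there is a holomorphic bijection from 𝔹ₙ onto D whose inverse is holomorphic) and which is not a Runge domain. -/
open Metric Filter Set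

noncomputable section

/-- The constant `2π / log 4`. -/
def tauC : ℂ := ((2 * Real.pi / Real.log 4 : ℝ) : ℂ)

/-- The spiralling function `q(s) = (4/3 - s)^{iτ}`. -/
def qF (s : ℂ) : ℂ := Complex.exp (Complex.I * tauC * Complex.log (4 / 3 - s))

lemma log4_pos : 0 < Real.log 4 := Real.log_pos (by norm_num)

lemma tauC_ne : tauC ≠ 0 := by
  unfold tauC
  have := log4_pos
  have := Real.pi_pos
  exact_mod_cast (by positivity : (2 * Real.pi / Real.log 4 : ℝ) ≠ 0)

lemma tauC_mul_log4 : tauC * (Real.log 4 : ℝ) = 2 * Real.pi := by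
  unfold tauC
  have := log4_pos.ne'
  rw [← Complex.ofReal_mul, div_mul_cancel₀ _ this]
  push_cast; rfl

lemma mem_slit {s : ℂ} (hs : ‖s‖ < 11 / 10) : (4 / 3 - s) ∈ Complex.slitPlane := by
  left
  have h1 := Complex.re_le_norm s
  have : (4 / 3 - s : ℂ).re = 4 / 3 - s.re := by
    rw [Complex.sub_re]; norm_num
  rw [this]; linarith

lemma qF_hasDerivAt {s : ℂ} (hs : ‖s‖ < 11 / 10) :
    HasDerivAt qF (qF s * (Complex.I * tauC * (-1 / (4 / 3 - s)))) s := by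
  have h1 : HasDerivAt (fun s : ℂ => 4 / 3 - s) (-1) s := by
    simpa using (hasDerivAt_id s).const_sub (4 / 3 : ℂ)
  exact ((h1.clog (mem_slit hs)).const_mul (Complex.I * tauC)).cexp

lemma qF_deriv_ne {s : ℂ} (hs : ‖s‖ < 11 / 10) :
    qF s * (Complex.I * tauC * (-1 / (4 / 3 - s))) ≠ 0 := by
  have := Complex.slitPlane_ne_zero (mem_slit hs)
  refine mul_ne_zero (Complex.exp_ne_zero _) (mul_ne_zero (mul_ne_zero Complex.I_ne_zero tauC_ne) ?_)
  exact div_ne_zero (by norm_num) this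

lemma four_zpow (k : ℤ) : Complex.exp (k * (Real.log 4 : ℝ)) = (4 : ℂ) ^ k := by
  rw [Complex.exp_int_mul, ← Complex.ofReal_exp, Real.exp_log (by norm_num)]
  norm_num

lemma qF_eq {s t : ℂ} (hs : ‖s‖ < 11 / 10) (ht : ‖t‖ < 11 / 10) (h : qF s = qF t) :
    s = t ∨ s = -4 * (1 - t) ∨ t = -4 * (1 - s) := by
  unfold qF at h
  obtain ⟨k, hk⟩ := Complex.exp_eq_exp_iff_exists_int.1 h
  have hl := Complex.slitPlane_ne_zero (mem_slit hs)
  have hl' := Complex.slitPlane_ne_zero (mem_slit ht)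
  have h2 : Complex.log (4 / 3 - s) = Complex.log (4 / 3 - t) + k * (Real.log 4 : ℝ) := by
    have h3 : Complex.I * tauC ≠ 0 := mul_ne_zero Complex.I_ne_zero tauC_ne
    apply mul_left_cancel₀ h3
    rw [hk]
    linear_combination (-Complex.I * k) * tauC_mul_log4
  have h4 : 4 / 3 - s = (4 / 3 - t) * (4 : ℂ) ^ k := by
    rw [← Complex.exp_log hl, h2, Complex.exp_add, Complex.exp_log hl', four_zpow]
  have h5 : ‖(4 / 3 - s : ℂ)‖ = ‖(4 / 3 - t : ℂ)‖ * (4 : ℝ) ^ k := by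
    rw [h4, norm_mul, norm_zpow]; norm_num
  have b1 : ∀ u : ℂ, ‖u‖ < 11 / 10 → 7 / 30 < ‖(4 / 3 - u : ℂ)‖ ∧ ‖(4 / 3 - u : ℂ)‖ < 73 / 30 := by
    intro u hu
    have e : ‖(4 / 3 : ℂ)‖ = 4 / 3 := by norm_num
    have a1 := norm_sub_norm_le (4 / 3 : ℂ) u
    have a2 := norm_sub_le (4 / 3 : ℂ) u
    rw [e] at a1 a2
    constructor <;> linarith
  obtain ⟨s1, s2⟩ := b1 s hs
  obtain ⟨t1, t2⟩ := b1 t ht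
  have k1 : k < 2 := by
    by_contra hc
    push Not at hc
    have : (4 : ℝ) ^ (2 : ℤ) ≤ (4 : ℝ) ^ k := zpow_le_zpow_right₀ (by norm_num) hc
    norm_num at this
    nlinarith
  have k2 : -2 < k := by
    by_contra hc
    push Not at hc
    have : (4 : ℝ) ^ k ≤ (4 : ℝ) ^ (-2 : ℤ) := zpow_le_zpow_right₀ (by norm_num) hc
    norm_num at this
    nlinarith
  have : k = -1 ∨ k = 0 ∨ k = 1 := by omega
  rcases this with rfl | rfl | rfl
  · right; right
    rw [zpow_neg_one] at h4
    linear_combination 4 * h4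
  · left
    rw [zpow_zero] at h4
    linear_combination -h4
  · right; left
    rw [zpow_one] at h4
    linear_combination -h4

lemma qF_zero_one : qF 1 = qF 0 := by
  unfold qF
  rw [Complex.exp_eq_exp_iff_exists_int]
  refine ⟨-1, ?_⟩
  have h : Complex.log (4 / 3 - 0) = Complex.log (4 / 3 - 1) + (Real.log 4 : ℝ) := by
    have e1 : (4 / 3 - 0 : ℂ) = ((4 / 3 : ℝ) : ℂ) := by push_cast; ring
    have e2 : (4 / 3 - 1 : ℂ) = ((1 / 3 : ℝ) : ℂ) := by push_cast; ring
    rw [e1, e2, ← Complex.ofReal_log (by norm_num), ← Complex.ofReal_log (by norm_num),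
      ← Complex.ofReal_add, ← Real.log_mul (by norm_num) (by norm_num)]
    norm_num
  rw [h]
  push_cast
  have := tauC_mul_log4
  linear_combination (-Complex.I) * this

/-- The auxiliary function `p(s) = (q(s) - q(0)) / (s (1 - s))`. -/
def pF (s : ℂ) : ℂ := - dslope (dslope qF 0) 1 s

lemma pF_diff : DifferentiableOn ℂ pF (ball 0 (11 / 10)) := by
  have h0 : ball (0 : ℂ) (11 / 10) ∈ nhds (0 : ℂ) := ball_mem_nhds _ (by norm_num)
  have h1 : ball (0 : ℂ) (11 / 10) ∈ nhds (1 : ℂ) :=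
    isOpen_ball.mem_nhds (by simp; norm_num)
  refine DifferentiableOn.neg ?_
  rw [Complex.differentiableOn_dslope h1, Complex.differentiableOn_dslope h0]
  intro s hs
  exact (qF_hasDerivAt (by simpa using hs)).differentiableAt.differentiableWithinAt

lemma pF_eq (s : ℂ) : s * (1 - s) * pF s = qF s - qF 0 := by
  have h1 : s * dslope qF 0 s = qF s - qF 0 := by
    have := sub_smul_dslope qF 0 s
    simpa using this
  have h0 : dslope qF 0 1 = 0 := by
    rw [dslope_of_ne _ (one_ne_zero), slope_def_field, qF_zero_one]; simp
  have h2 : (s - 1) * dslope (dslope qF 0) 1 s = dslope qF 0 s := by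
    have := sub_smul_dslope (dslope qF 0) 1 s
    rw [h0] at this
    simpa using this
  unfold pF
  linear_combination h1 + s * h2

lemma pF_deriv {s : ℂ} (hs : ‖s‖ < 11 / 10) :
    (1 - 2 * s) * pF s + s * (1 - s) * deriv pF s =
      qF s * (Complex.I * tauC * (-1 / (4 / 3 - s))) := by
  have hp : HasDerivAt pF (deriv pF s) s :=
    (pF_diff.differentiableAt (isOpen_ball.mem_nhds (by simpa using hs))).hasDerivAt
  have h1 : HasDerivAt (fun s : ℂ => s * (1 - s)) (1 * (1 - s) + s * (-1)) s :=
    (hasDerivAt_id s).mul (by simpa using (hasDerivAt_id s).const_sub (1 : ℂ))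
  have h2 := h1.mul hp
  have h3 : ((fun s : ℂ => s * (1 - s)) * pF) = fun s => qF s - qF 0 := by
    funext s; exact pF_eq s
  rw [h3] at h2
  have h4 := h2.unique ((qF_hasDerivAt hs).sub_const (qF 0))
  linear_combination h4

lemma pF_norm : ‖pF 1‖ = 4 * ‖pF 0‖ := by
  have h0 := pF_deriv (s := 0) (by norm_num)
  have h1 := pF_deriv (s := 1) (by norm_num)
  rw [qF_zero_one] at h1
  have : pF 1 = - 4 * pF 0 := by
    linear_combination -h1 + 4 * h0
  rw [this, norm_mul]; norm_num

lemma pF_ne {s : ℂ} (hs : ‖s‖ < 11 / 10) : pF s ≠ 0 := by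
  intro h
  by_cases h0 : s * (1 - s) = 0
  · have := pF_deriv hs
    rw [h, h0] at this
    apply qF_deriv_ne hs
    rw [← this]; ring
  · have h1 := pF_eq s
    rw [h, mul_zero] at h1
    rcases qF_eq hs (by norm_num : ‖(0 : ℂ)‖ < 11 / 10) (sub_eq_zero.1 h1.symm) with e | e | e
    · rw [e] at h0; simp at h0
    · rw [e] at hs; norm_num at hs
    · apply h0
      linear_combination (s / 4) * e

section Construction

variable {n : ℕ} (a b : Fin n)

/-- The quadratic function `s = (11/5) z w`. -/
def sF (x : En n) : ℂ := 11 / 5 * (x a * x b)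

/-- The injective holomorphic map `(z, w, u) ↦ (z p(s), w (1 - s), u)`. -/
def mapF (x : En n) : En n :=
  WithLp.toLp 2 fun i =>
    if i = a then x a * pF (sF a b x) else if i = b then x b * (1 - sF a b x) else x i

/-- Derivative of `sF`. -/
def sD (x : En n) : En n →L[ℂ] ℂ :=
  (11 / 5 : ℂ) • (x a • (EuclideanSpace.proj b : En n →L[ℂ] ℂ)
    + x b • (EuclideanSpace.proj a : En n →L[ℂ] ℂ))

/-- Derivative of `mapF`. -/
def mapD (x : En n) : En n →L[ℂ] En n :=
  ((PiLp.continuousLinearEquiv 2 ℂ (fun _ : Fin n => ℂ)).symm : (Fin n → ℂ) →L[ℂ] En n) ∘L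
    ContinuousLinearMap.pi fun i =>
      if i = a then x a • (deriv pF (sF a b x) • sD a b x)
        + pF (sF a b x) • (EuclideanSpace.proj a : En n →L[ℂ] ℂ)
      else if i = b then x b • (-sD a b x)
        + (1 - sF a b x) • (EuclideanSpace.proj b : En n →L[ℂ] ℂ)
      else EuclideanSpace.proj i

variable {a b}

lemma ball_bound (hab : a ≠ b) {x : En n} (hx : x ∈ Ball n) :
    ‖x a‖ ^ 2 + ‖x b‖ ^ 2 < 1 := by
  have h1 : ‖x‖ < 1 := by simpa [Ball] using hx
  have h2 : ‖x‖ ^ 2 < 1 := by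
    have := norm_nonneg x
    nlinarith
  rw [EuclideanSpace.norm_sq_eq] at h2
  have h3 : ∑ i ∈ ({a, b} : Finset (Fin n)), ‖x i‖ ^ 2 ≤ ∑ i, ‖x i‖ ^ 2 :=
    Finset.sum_le_sum_of_subset_of_nonneg (Finset.subset_univ _) (fun _ _ _ => by positivity)
  rw [Finset.sum_pair hab] at h3
  linarith

lemma sF_norm (x : En n) : ‖sF a b x‖ = 11 / 5 * (‖x a‖ * ‖x b‖) := by
  unfold sF
  rw [norm_mul, norm_mul]; norm_num

lemma sF_bound (hab : a ≠ b) {x : En n} (hx : x ∈ Ball n) : ‖sF a b x‖ < 11 / 10 := by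
  have h := ball_bound hab hx
  rw [sF_norm]
  nlinarith [sq_nonneg (‖x a‖ - ‖x b‖)]

lemma sF_hasD (x : En n) : HasStrictFDerivAt (sF a b) (sD a b x) x := by
  have ha : HasStrictFDerivAt (fun x : En n => x a) (EuclideanSpace.proj a : En n →L[ℂ] ℂ) x :=
    (EuclideanSpace.proj a : En n →L[ℂ] ℂ).hasStrictFDerivAt
  have hb : HasStrictFDerivAt (fun x : En n => x b) (EuclideanSpace.proj b : En n →L[ℂ] ℂ) x :=
    (EuclideanSpace.proj b : En n →L[ℂ] ℂ).hasStrictFDerivAt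
  exact (ha.mul hb).const_mul (11 / 5 : ℂ)

lemma mapF_hasD (hab : a ≠ b) {x : En n} (hx : x ∈ Ball n) :
    HasStrictFDerivAt (mapF a b) (mapD a b x) x := by
  have hp : ∀ i, HasStrictFDerivAt (fun x : En n => x i)
      (EuclideanSpace.proj i : En n →L[ℂ] ℂ) x := fun i =>
    (EuclideanSpace.proj i : En n →L[ℂ] ℂ).hasStrictFDerivAt
  have hs := sF_hasD (a := a) (b := b) x
  have hU : ball (0 : ℂ) (11 / 10) ∈ nhds (sF a b x) :=
    isOpen_ball.mem_nhds (by simpa using sF_bound hab hx)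
  have hpF : HasStrictDerivAt pF (deriv pF (sF a b x)) (sF a b x) :=
    (pF_diff.analyticAt hU).hasStrictDerivAt
  rw [hasStrictFDerivAt_euclidean]
  intro i
  by_cases hia : i = a
  · have e1 : (fun x => (mapF a b x).ofLp i) = fun x => x a * pF (sF a b x) := by
      funext x; simp [mapF, hia]
    have e2 : (PiLp.proj 2 (fun _ => ℂ) i : En n →L[ℂ] ℂ) ∘SL mapD a b x
        = x a • (deriv pF (sF a b x) • sD a b x)
        + pF (sF a b x) • (EuclideanSpace.proj a : En n →L[ℂ] ℂ) := by
      ext v; simp [mapD, hia]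
    rw [e1, e2]
    exact (hp a).mul (hpF.comp_hasStrictFDerivAt x hs)
  · by_cases hib : i = b
    · have e1 : (fun x => (mapF a b x).ofLp i) = fun x => x b * (1 - sF a b x) := by
        funext x; simp [mapF, hib, hab.symm]
      have e2 : (PiLp.proj 2 (fun _ => ℂ) i : En n →L[ℂ] ℂ) ∘SL mapD a b x
          = x b • (-sD a b x)
          + (1 - sF a b x) • (EuclideanSpace.proj b : En n →L[ℂ] ℂ) := by
        ext v; simp [mapD, hib, hab.symm]
      rw [e1, e2]
      exact (hp b).mul (hs.const_sub 1)
    · have e1 : (fun x => (mapF a b x).ofLp i) = fun x => x i := by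
        funext x; simp [mapF, hia, hib]
      have e2 : (PiLp.proj 2 (fun _ => ℂ) i : En n →L[ℂ] ℂ) ∘SL mapD a b x
          = EuclideanSpace.proj i := by
        ext v; simp [mapD, hia, hib]
      rw [e1, e2]
      exact hp i

lemma mapD_inj (hab : a ≠ b) {x : En n} (hx : x ∈ Ball n) :
    Function.Injective (mapD a b x : En n →ₗ[ℂ] En n) := by
  rw [← LinearMap.ker_eq_bot, LinearMap.ker_eq_bot']
  intro v hv
  have hc : ∀ i, (mapD a b x v) i = 0 := by
    intro i
    have : mapD a b x v = 0 := hv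
    rw [this]; rfl
  have ha := hc a
  have hb := hc b
  simp [mapD, sD] at ha
  simp [mapD, sD, hab.symm] at hb
  set s := sF a b x with hs
  have hs' : s = 11 / 5 * (x a * x b) := hs
  have hdet := pF_deriv (sF_bound hab hx)
  rw [← hs] at hdet
  have hne := qF_deriv_ne (sF_bound hab hx)
  rw [← hs, ← hdet] at hne
  have va : v a = 0 := by
    apply (mul_eq_zero.1 _).resolve_left hne
    rw [hs'] at ha hb ⊢
    linear_combination (1 - 2 * (11 / 5 * (x a * x b))) * ha
      - (11 / 5 * x a * x a * deriv pF (11 / 5 * (x a * x b))) * hb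
  have vb : v b = 0 := by
    apply (mul_eq_zero.1 _).resolve_left hne
    rw [hs'] at ha hb ⊢
    linear_combination (11 / 5 * x b * x b) * ha
      + (pF (11 / 5 * (x a * x b)) + (11 / 5 * (x a * x b)) * deriv pF (11 / 5 * (x a * x b))) * hb
  ext i
  by_cases hia : i = a
  · rw [hia]; simpa using va
  · by_cases hib : i = b
    · rw [hib]; simpa using vb
    · have := hc i
      simpa [mapD, hia, hib] using this

/-- The excluded collision. -/
lemma no_collision (hab : a ≠ b) {x y : En n} (hx : x ∈ Ball n) (hy : y ∈ Ball n)
    (h1 : x a * pF (sF a b x) = y a * pF (sF a b y))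
    (h2 : x b * (1 - sF a b x) = y b * (1 - sF a b y))
    (h : sF a b x = -4 * (1 - sF a b y)) : False := by
  have bx := ball_bound hab hx
  have bY := ball_bound hab hy
  have sy := sF_bound hab hy
  have nx := norm_nonneg (x a)
  have ny := norm_nonneg (y b)
  have lx : ‖x a‖ < 1 := by nlinarith [sq_nonneg ‖x b‖]
  have ly : ‖y b‖ < 1 := by nlinarith [sq_nonneg ‖y a‖]
  by_cases hxb : x b = 0
  · have s0 : sF a b x = 0 := by unfold sF; rw [hxb]; ring
    have s1 : sF a b y = 1 := by
      rw [s0] at h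
      linear_combination (-1 / 4 : ℂ) * h
    rw [s0, s1] at h1
    have h3 := congrArg norm h1
    rw [norm_mul, norm_mul, pF_norm] at h3
    have hp : 0 < ‖pF 0‖ := norm_pos_iff.2 (pF_ne (by norm_num))
    have h4 : ‖x a‖ = 4 * ‖y a‖ := by
      apply mul_right_cancel₀ hp.ne'
      rw [h3]; ring
    have h5 := sF_norm (a := a) (b := b) y
    rw [s1, norm_one] at h5
    have := norm_nonneg (y a)
    nlinarith
  · have h4 : 1 - sF a b x = -(11 / 20) * (x a * y b) := by
      apply mul_left_cancel₀ hxb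
      rw [h2]
      have : sF a b x = 11 / 5 * (x a * x b) := rfl
      linear_combination (y b / 4) * h - (y b / 4) * this
    have h5 : ‖1 - sF a b x‖ < 11 / 20 := by
      rw [h4, norm_mul, norm_mul]
      have : ‖(-(11 / 20) : ℂ)‖ = 11 / 20 := by norm_num
      rw [this]
      nlinarith
    have h6 := Complex.re_le_norm (1 - sF a b x)
    have h7 := Complex.re_le_norm (sF a b y)
    have h8 : (sF a b x).re = -4 + 4 * (sF a b y).re := by
      rw [h]; simp; ring
    rw [Complex.sub_re, Complex.one_re, h8] at h6
    linarith

lemma mapF_a (x : En n) : mapF a b x a = x a * pF (sF a b x) := by simp [mapF]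

lemma mapF_b (hab : a ≠ b) (x : En n) : mapF a b x b = x b * (1 - sF a b x) := by
  simp [mapF, hab.symm]

lemma mapF_inj (hab : a ≠ b) : Set.InjOn (mapF a b) (Ball n) := by
  intro x hx y hy hxy
  have h1 : x a * pF (sF a b x) = y a * pF (sF a b y) := by
    rw [← mapF_a, ← mapF_a, hxy]
  have h2 : x b * (1 - sF a b x) = y b * (1 - sF a b y) := by
    rw [← mapF_b hab, ← mapF_b hab, hxy]
  have hq : qF (sF a b x) = qF (sF a b y) := by
    have e1 := pF_eq (sF a b x)
    have e2 := pF_eq (sF a b y)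
    have f1 : sF a b x = 11 / 5 * (x a * x b) := rfl
    have f2 : sF a b y = 11 / 5 * (y a * y b) := rfl
    have e3 : sF a b x * (1 - sF a b x) * pF (sF a b x)
        = sF a b y * (1 - sF a b y) * pF (sF a b y) := by
      calc sF a b x * (1 - sF a b x) * pF (sF a b x)
          = 11 / 5 * ((x a * pF (sF a b x)) * (x b * (1 - sF a b x))) := by
            linear_combination (1 - sF a b x) * pF (sF a b x) * f1
        _ = 11 / 5 * ((y a * pF (sF a b y)) * (y b * (1 - sF a b y))) := by rw [h1, h2]
        _ = _ := by
            linear_combination -(1 - sF a b y) * pF (sF a b y) * f2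
    linear_combination e3 - e1 + e2
  rcases qF_eq (sF_bound hab hx) (sF_bound hab hy) hq with h | h | h
  · have hp := pF_ne (sF_bound hab hy)
    rw [h] at h1 h2
    have ha : x a = y a := mul_right_cancel₀ hp h1
    have hb : x b = y b := by
      by_cases hs : 1 - sF a b y = 0
      · have f1 : sF a b x = 11 / 5 * (x a * x b) := rfl
        have f2 : sF a b y = 11 / 5 * (y a * y b) := rfl
        have hya : y a ≠ 0 := by
          intro h0
          rw [f2, h0] at hs
          simp at hs
        apply mul_left_cancel₀ hya
        rw [ha] at f1
        linear_combination (5 / 11 : ℂ) * (h - f1 + f2)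
      · exact mul_right_cancel₀ hs h2
    ext i
    by_cases hia : i = a
    · rw [hia]; exact ha
    · by_cases hib : i = b
      · rw [hib]; exact hb
      · have := congrArg (fun v : En n => v i) hxy
        simpa [mapF, hia, hib] using this
  · exact (no_collision hab hx hy h1 h2 h).elim
  · exact (no_collision hab hy hx h1.symm h2.symm h).elim

/-- The derivative as a continuous linear equivalence. -/
lemma exists_equiv (hab : a ≠ b) {x : En n} (hx : x ∈ Ball n) :
    ∃ e : En n ≃L[ℂ] En n, HasStrictFDerivAt (mapF a b) (e : En n →L[ℂ] En n) x := by
  refine ⟨(LinearEquiv.ofInjectiveEndo _ (mapD_inj hab hx)).toContinuousLinearEquiv, ?_⟩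
  have e : (((LinearEquiv.ofInjectiveEndo _ (mapD_inj hab hx)).toContinuousLinearEquiv :
      En n ≃L[ℂ] En n) : En n →L[ℂ] En n) = mapD a b x := by
    ext v; rfl
  rw [e]
  exact mapF_hasD hab hx

lemma mapF_open (hab : a ≠ b) : IsOpen (mapF a b '' Ball n) := by
  rw [isOpen_iff_mem_nhds]
  rintro _ ⟨x, hx, rfl⟩
  obtain ⟨e, he⟩ := exists_equiv hab hx
  rw [← he.map_nhds_eq_of_equiv]
  exact image_mem_map (isOpen_ball.mem_nhds hx)

lemma inv_diff (hab : a ≠ b) :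
    DifferentiableOn ℂ (Function.invFunOn (mapF a b) (Ball n)) (mapF a b '' Ball n) := by
  rintro _ ⟨x, hx, rfl⟩
  obtain ⟨e, he⟩ := exists_equiv hab hx
  have h1 := he.to_localInverse.hasFDerivAt
  refine (HasFDerivAt.congr_of_eventuallyEq h1 ?_).differentiableAt.differentiableWithinAt
  have h2 := he.localInverse_tendsto (isOpen_ball.mem_nhds hx)
  filter_upwards [he.eventually_right_inverse, h2] with y hy1 hy2
  have hl := (mapF_inj hab).leftInvOn_invFunOn hy2
  rwa [hy1] at hl

lemma not_runge (hab : a ≠ b) : ¬ RungeOn n (mapF a b '' Ball n) := by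
  intro hR
  obtain ⟨P, hP, hlim⟩ := hR _ (inv_diff hab)
  rw [tendstoLocallyUniformlyOn_iff_forall_isCompact (mapF_open hab)] at hlim
  -- the analytic disc
  let δ : ℂ → En n := fun ζ => WithLp.toLp 2 fun i => if i = a then 2 / 3 * pF 1 * ζ else 0
  let c : ℂ → En n := fun ζ => WithLp.toLp 2 fun i =>
    if i = a then 2 / 3 * ζ else if i = b then 15 / 22 * ζ⁻¹ else 0
  have hcb : ∀ ζ ∈ sphere (0 : ℂ) 1, c ζ ∈ Ball n := by
    intro ζ hζ
    have hn : ‖ζ‖ = 1 := by simpa using hζ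
    have : ‖c ζ‖ ^ 2 < 1 := by
      rw [EuclideanSpace.norm_sq_eq, ← Finset.sum_subset (Finset.subset_univ {a, b}),
        Finset.sum_pair hab]
      · simp [c, hab.symm, hn]; norm_num
      · intro i _ hi
        simp only [Finset.mem_insert, Finset.mem_singleton, not_or] at hi
        simp [c, hi.1, hi.2]
    have h2 : ‖c ζ‖ < 1 := by nlinarith [norm_nonneg (c ζ)]
    simpa [Ball] using h2
  have hFc : ∀ ζ ∈ sphere (0 : ℂ) 1, mapF a b (c ζ) = δ ζ := by
    intro ζ hζ
    have hne : ζ ≠ 0 := by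
      rintro rfl; simp at hζ
    have hs : sF a b (c ζ) = 1 := by
      simp [sF, c, hab.symm]
      field_simp
      norm_num
    ext i
    by_cases hia : i = a
    · simp [mapF, hs, hia, δ, c]; ring
    · by_cases hib : i = b
      · simp [mapF, hs, hib, δ, hab.symm]
      · simp [mapF, hia, hib, δ, c]
  have hδ : Continuous δ := by
    refine (PiLp.continuous_toLp 2 _).comp (continuous_pi fun i => ?_)
    split_ifs <;> fun_prop
  have hK : IsCompact (δ '' sphere (0 : ℂ) 1) := (isCompact_sphere 0 1).image hδ
  have hKs : δ '' sphere (0 : ℂ) 1 ⊆ mapF a b '' Ball n := by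
    rintro _ ⟨ζ, hζ, rfl⟩
    exact ⟨c ζ, hcb ζ hζ, hFc ζ hζ⟩
  have hu := hlim _ hKs hK
  rw [Metric.tendstoUniformlyOn_iff] at hu
  obtain ⟨k, hk⟩ := (hu (1 / 3) (by norm_num)).exists
  obtain ⟨q, hq⟩ := hP k
  let h : ℂ → ℂ := fun ζ => P k (δ ζ) b
  have hh : Differentiable ℂ h := by
    have e : h = fun ζ => MvPolynomial.eval (fun j => δ ζ j) (q b) := by
      funext ζ; exact hq _ _
    rw [e]
    have hd : ∀ j, Differentiable ℂ fun ζ => δ ζ j := by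
      intro j
      by_cases hj : j = a
      · simp only [δ, hj, if_true]; fun_prop
      · simp only [δ, hj, if_false]; fun_prop
    induction q b using MvPolynomial.induction_on with
    | C r => simp
    | add p r hp hr => simp only [map_add]; exact hp.add hr
    | mul_X p j hp => simp only [map_mul, MvPolynomial.eval_X]; exact hp.mul (hd j)
  have happ : ∀ ζ ∈ sphere (0 : ℂ) 1, ‖15 / 22 * ζ⁻¹ - h ζ‖ ≤ 1 / 3 := by
    intro ζ hζ
    have h1 := hk (δ ζ) ⟨ζ, hζ, rfl⟩
    rw [← hFc ζ hζ, (mapF_inj hab).leftInvOn_invFunOn (hcb ζ hζ), hFc ζ hζ, dist_eq_norm] at h1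
    have h2 := PiLp.norm_apply_le (c ζ - P k (δ ζ)) b
    have h3 : (c ζ - P k (δ ζ)) b = 15 / 22 * ζ⁻¹ - h ζ := by
      simp [c, h, hab.symm]
    rw [h3] at h2
    linarith
  have hmax : ‖(15 / 22 : ℂ) - 0 * h 0‖ ≤ 1 / 3 := by
    have hdiff : Differentiable ℂ fun ζ : ℂ => (15 / 22 : ℂ) - ζ * h ζ := by fun_prop
    refine Complex.norm_le_of_forall_mem_frontier_norm_le (U := ball (0 : ℂ) 1)
      (f := fun ζ : ℂ => (15 / 22 : ℂ) - ζ * h ζ) isBounded_ball hdiff.diffContOnCl ?_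
      (subset_closure (mem_ball_self one_pos))
    intro ζ hζ
    rw [frontier_ball _ one_ne_zero] at hζ
    have hne : ζ ≠ 0 := by
      rintro rfl; simp at hζ
    have hn : ‖ζ‖ = 1 := by simpa using hζ
    have e : (15 / 22 : ℂ) - ζ * h ζ = ζ * (15 / 22 * ζ⁻¹ - h ζ) := by
      field_simp
    rw [e, norm_mul, hn, one_mul]
    exact happ ζ hζ
  norm_num at hmax

end Construction

/-- For n ≥ 2 there is an open connected set D ⊆ ℂⁿ, biholomorphic to 𝔹ₙ
(holomorphic bijection with holomorphic inverse), which is not a Runge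
domain. -/
theorem exists_nonRunge_biholomorphic_to_ball (n : ℕ) (hn : 2 ≤ n) :
    ∃ D : Set (En n), IsOpen D ∧ IsConnected D ∧
      (∃ f g : En n → En n,
        DifferentiableOn ℂ f (Ball n) ∧ Set.InjOn f (Ball n) ∧
        f '' Ball n = D ∧ DifferentiableOn ℂ g D ∧
        (∀ z ∈ Ball n, g (f z) = z)) ∧
      ¬ RungeOn n D := by
  have hab : (⟨0, by omega⟩ : Fin n) ≠ ⟨1, by omega⟩ := by simp
  refine ⟨mapF ⟨0, by omega⟩ ⟨1, by omega⟩ '' Ball n, mapF_open hab, ?_,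
    ⟨mapF ⟨0, by omega⟩ ⟨1, by omega⟩, Function.invFunOn (mapF ⟨0, by omega⟩ ⟨1, by omega⟩) (Ball n),
      ?_, mapF_inj hab, rfl, inv_diff hab, fun z hz => (mapF_inj hab).leftInvOn_invFunOn hz⟩,
    not_runge hab⟩
  · refine IsConnected.image ?_ _ ?_
    · exact ((convex_ball (0 : En n) 1).isPathConnected ⟨0, by simp⟩).isConnected
    · intro x hx
      exact (mapF_hasD hab hx).hasFDerivAt.continuousAt.continuousWithinAt
  · intro x hx
    exact (mapF_hasD hab hx).hasFDerivAt.differentiableAt.differentiableWithinAt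

end
end
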